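/- Let U ⊔ {v} = X be a partition of the finite basis X of the free group F(X), and let u ∈ ⟨U⟩ be cyclically reduced and nontrivial. Then the Stallings graph of the subgroup ⟨U, v⁻¹uv⟩ has exactly one v-labeled edge, and deleting it yields two connected components, one of which (the component carrying the loop labeled u) has rank one. -/

import Mathlib

/-- An `X`-digraph: a finite directed graph with edges labeled by elements of `X`. -/
structure XDigraph (X : Type) where
  V : Type
  E : Type
  [fintypeV : Fintype V]
  [fintypeE : Fintype E]
  [decV : DecidableEq V]
  [decE : DecidableEq E]
  init : E → V
  term : E → V
  lab : E → X

attribute [instance] XDigraph.fintypeV XDigraph.fintypeE XDigraph.decV XDigraph.decE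

namespace XDigraph

variable {X : Type} (S : XDigraph X)

/-- A dart is an edge together with a direction (`true` = forward). -/
abbrev Dart := S.E × Bool

def dInit (d : S.Dart) : S.V := if d.2 then S.init d.1 else S.term d.1

def dTerm (d : S.Dart) : S.V := if d.2 then S.term d.1 else S.init d.1

/-- The label of a dart, as an element of `X ∪ X⁻¹` (encoded as `X × Bool`). -/
def dLab (d : S.Dart) : X × Bool := (S.lab d.1, d.2)

def dRev (d : S.Dart) : S.Dart := (d.1, !d.2)

/-- The degree of a vertex: the number of darts pointing into it. -/
def degree (v : S.V) : ℕ := (Finset.univ.filter (fun d : S.Dart => S.dTerm d = v)).card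

/-- The hyperlink of a vertex: the set of labels of darts pointing into it. -/
def hyperlink (v : S.V) : Set (X × Bool) := {p | ∃ d : S.Dart, S.dTerm d = v ∧ S.dLab d = p}

/-- `S` is folded if darts into the same vertex have distinct labels. -/
def Folded : Prop := ∀ v : S.V, Set.InjOn S.dLab {d : S.Dart | S.dTerm d = v}

def Adj (u v : S.V) : Prop := ∃ d : S.Dart, S.dInit d = u ∧ S.dTerm d = v

def Connected : Prop := Nonempty S.V ∧ ∀ u v : S.V, Relation.EqvGen S.Adj u v

/-- A cyclically reduced graph has no leaves (vertices of degree one). -/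
def NoLeaf : Prop := ∀ v : S.V, S.degree v ≠ 1

def IsPath (p : List S.Dart) : Prop := p.Chain' (fun d d' => S.dTerm d = S.dInit d')

/-- A path is immersed if no dart is immediately followed by its reverse. -/
def Immersed (p : List S.Dart) : Prop := p.Chain' (fun d d' => d' ≠ S.dRev d)

def IsLoopAt (p : List S.Dart) (v : S.V) : Prop :=
  S.IsPath p ∧ ∀ h : p ≠ [], S.dInit (p.head h) = v ∧ S.dTerm (p.getLast h) = v

def pathLab (p : List S.Dart) : List (X × Bool) := p.map S.dLab

/-- Adjacency using only edges satisfying `P`. -/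
def AdjOn (P : S.E → Prop) (u v : S.V) : Prop :=
  ∃ e : S.E, P e ∧ ((S.init e = u ∧ S.term e = v) ∨ (S.init e = v ∧ S.term e = u))

end XDigraph

section Defs

variable {X : Type} [DecidableEq X]

/-- A list of letters in `X ∪ X⁻¹` is freely reduced: no `x x⁻¹` or `x⁻¹ x` subword. -/
def ReducedList (l : List (X × Bool)) : Prop :=
  List.Chain' (fun p q : X × Bool => p.1 ≠ q.1 ∨ p.2 = q.2) l

/-- `w` is cyclically reduced: every cyclic permutation of its reduced word is freely reduced. -/
def CyclRed (w : FreeGroup X) : Prop :=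
  ∀ l : List (X × Bool), w.toWord.IsRotated l → ReducedList l

/-- `w` is readable as the label of an immersed loop of `S` based at `v`. -/
def Reads (S : XDigraph X) (v : S.V) (w : FreeGroup X) : Prop :=
  ∃ p : List S.Dart, S.Immersed p ∧ S.IsLoopAt p v ∧ S.pathLab p = w.toWord

/-- `S`, with basepoint `base`, is the Stallings graph of the subgroup `H`:
a folded connected core graph whose immersed loops at `base` read exactly the elements of `H`. -/
def PRep (S : XDigraph X) (base : S.V) (H : Subgroup (FreeGroup X)) : Prop :=
  S.Folded ∧ S.Connected ∧ (∀ v : S.V, v ≠ base → 2 ≤ S.degree v) ∧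
    ∀ w : FreeGroup X, w ∈ H ↔ Reads S base w

/-- `S` is the cyclically reduced Stallings graph representing the conjugacy class of `H`:
a folded, connected, cyclically reduced graph whose immersed loops read exactly the
cyclically reduced elements of `F(X)` that are conjugate into `H`. -/
def CRep (S : XDigraph X) (H : Subgroup (FreeGroup X)) : Prop :=
  S.Folded ∧ S.Connected ∧ S.NoLeaf ∧
    ∀ w : FreeGroup X, CyclRed w →
      ((∃ v : S.V, Reads S v w) ↔ ∃ c : FreeGroup X, c * w * c⁻¹ ∈ H)

/-- The element of `F(X)` given by a single letter of `X ∪ X⁻¹`. -/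
def iota (p : X × Bool) : FreeGroup X :=
  if p.2 then FreeGroup.of p.1 else (FreeGroup.of p.1)⁻¹

/-- `φ` is the type II Whitehead automorphism with cut `C` and multiplier `m`. -/
def IsWhiteheadII (φ : FreeGroup X ≃* FreeGroup X) (C : Finset (X × Bool)) (m : X × Bool) :
    Prop :=
  m ∈ C ∧ (m.1, !m.2) ∉ C ∧
    ∀ x : X, φ (FreeGroup.of x) =
      if x = m.1 then FreeGroup.of x
      else (if (x, false) ∈ C then (iota m)⁻¹ else 1) * FreeGroup.of x *
           (if (x, true) ∈ C then iota m else 1)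

/-- The number of edges of `S` labeled `x`. -/
def edgeCount (S : XDigraph X) (x : X) : ℕ :=
  (Finset.univ.filter (fun e : S.E => S.lab e = x)).card

/-- The hyperlink of a vertex, as a finset. -/
def hyperlinkF (S : XDigraph X) (v : S.V) : Finset (X × Bool) :=
  (Finset.univ.filter (fun d : S.Dart => S.dTerm d = v)).image S.dLab

/-- The capacity of the cut `C` in the Whitehead hypergraph of `S`: the number of vertices
whose hyperlink meets both `C` and its complement. -/
def cap (S : XDigraph X) (C : Finset (X × Bool)) : ℕ :=
  (Finset.univ.filter
    (fun v : S.V => (hyperlinkF S v ∩ C).Nonempty ∧ (hyperlinkF S v \ C).Nonempty)).card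

/-- The degree of the letter `m` in the Whitehead hypergraph of `S`: the number of vertices
whose hyperlink contains `m`. -/
def wdeg (S : XDigraph X) (m : X × Bool) : ℕ :=
  (Finset.univ.filter (fun v : S.V => m ∈ hyperlinkF S v)).card

/-- The number of connected components of the subgraph of `S` spanned by the edges
satisfying `P`, on the vertex set `{v | W v}`. -/
noncomputable def componentsCount (S : XDigraph X) (P : S.E → Prop) (W : S.V → Prop) : ℕ :=
  Nat.card (Quotient (Setoid.comap (Subtype.val : {v : S.V // W v} → S.V)
    (Relation.EqvGen.setoid (S.AdjOn P))))

/-- The connected component of `u` in `S - e₀` has rank one (first Betti number one),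
i.e. it has as many edges as vertices. -/
def ComponentRankOne (S : XDigraph X) (e₀ : S.E) (u : S.V) : Prop :=
  Nat.card {e : S.E // e ≠ e₀ ∧ Relation.EqvGen (S.AdjOn (· ≠ e₀)) u (S.init e)} =
    Nat.card {v : S.V // Relation.EqvGen (S.AdjOn (· ≠ e₀)) u v}

/-- Property (L): `S` has a unique `v`-labeled edge `e₀`, and `S - e₀` has exactly two
connected components, at least one of which has rank one. -/
def PropertyL (S : XDigraph X) (v : X) : Prop :=
  ∃ e₀ : S.E, S.lab e₀ = v ∧ (∀ e : S.E, S.lab e = v → e = e₀) ∧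
    componentsCount S (· ≠ e₀) (fun _ => True) = 2 ∧
    ∃ u : S.V, ComponentRankOne S e₀ u

/-- Property (S) for the partition `X = A ⊔ Aᶜ`: `S` is connected and cyclically reduced,
the `A`-edges form a bouquet of single-edge loops at one vertex, and the subgraph spanned
by the remaining edges is connected of rank one. -/
def PropertyS (S : XDigraph X) (A : Set X) : Prop :=
  S.Connected ∧ S.NoLeaf ∧
    (∃ v₀ : S.V, ∀ e : S.E, S.lab e ∈ A → S.init e = v₀ ∧ S.term e = v₀) ∧
    Nat.card {e : S.E // S.lab e ∉ A} =
      Nat.card {w : S.V // ∃ e : S.E, S.lab e ∉ A ∧ (S.init e = w ∨ S.term e = w)} ∧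
    ∀ u w : S.V, (∃ e : S.E, S.lab e ∉ A ∧ (S.init e = u ∨ S.term e = u)) →
      (∃ e : S.E, S.lab e ∉ A ∧ (S.init e = w ∨ S.term e = w)) →
      Relation.EqvGen (S.AdjOn (fun e => S.lab e ∉ A)) u w

/-- An immersion of `X`-digraphs: a label- and orientation-preserving graph map which is
locally injective on links. -/
structure Immersion (S T : XDigraph X) where
  onV : S.V → T.V
  onE : S.E → T.E
  map_init : ∀ e : S.E, T.init (onE e) = onV (S.init e)
  map_term : ∀ e : S.E, T.term (onE e) = onV (S.term e)
  map_lab : ∀ e : S.E, T.lab (onE e) = S.lab e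
  locInj : ∀ (v : S.V) (d d' : S.Dart), S.dTerm d = v → S.dTerm d' = v →
    ((onE d.1, d.2) : T.Dart) = (onE d'.1, d'.2) → d = d'

/-- `K` is a proper free factor of `F(X)`: there is a nontrivial `L` with `F(X) = K ∗ L`. -/
def IsProperFreeFactor (K : Subgroup (FreeGroup X)) : Prop :=
  ∃ L : Subgroup (FreeGroup X), L ≠ ⊥ ∧
    Function.Bijective (Monoid.Coprod.lift K.subtype L.subtype)

end Defs

theorem reducedList_iff_isReduced {X : Type} {l : List (X × Bool)} :
    ReducedList l ↔ FreeGroup.IsReduced l :=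
  List.IsChain.iff fun _ _ => imp_iff_not_or.symm

theorem FreeGroup.IsCyclicallyReduced.isReduced_of_isRotated {X : Type} {l l' : List (X × Bool)}
    (h : FreeGroup.IsCyclicallyReduced l) (hr : l.IsRotated l') : FreeGroup.IsReduced l' := by
  obtain ⟨n, rfl⟩ := hr
  have h2 := (h.flatten_replicate 2).isReduced
  rw [List.rotate_eq_drop_append_take_mod]
  refine h2.infix ⟨l.take (n % l.length), l.drop (n % l.length), ?_⟩
  simp only [List.replicate, List.flatten_cons, List.flatten_nil, List.append_nil]
  rw [← List.append_assoc, List.take_append_drop, List.append_assoc, List.take_append_drop]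

theorem FreeGroup.isCyclicallyReduced_of_isRotated_isReduced {X : Type} {l : List (X × Bool)}
    (h : ∀ l', l.IsRotated l' → FreeGroup.IsReduced l') : FreeGroup.IsCyclicallyReduced l := by
  refine ⟨h l (List.IsRotated.refl l), ?_⟩
  cases l with
  | nil => simp
  | cons a t =>
    have h1 : FreeGroup.IsReduced (t ++ [a]) := h _ ⟨1, by simp⟩
    cases t using List.reverseRecOn with
    | nil => simp
    | append_singleton t b =>
      have := (List.isChain_append.1 h1).2.2
      simpa [List.getLast?_cons] using this

theorem cyclRed_iff_isCyclicallyReduced {X : Type} [DecidableEq X] {w : FreeGroup X} :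
    CyclRed w ↔ FreeGroup.IsCyclicallyReduced w.toWord :=
  ⟨fun h => FreeGroup.isCyclicallyReduced_of_isRotated_isReduced fun l hl =>
      reducedList_iff_isReduced.1 (h l hl),
    fun h _ hl => reducedList_iff_isReduced.2 (h.isReduced_of_isRotated hl)⟩

theorem FreeGroup.IsCyclicallyReduced.of_isRotated {X : Type} {l l' : List (X × Bool)}
    (h : FreeGroup.IsCyclicallyReduced l) (hr : l.IsRotated l') :
    FreeGroup.IsCyclicallyReduced l' :=
  FreeGroup.isCyclicallyReduced_of_isRotated_isReduced fun _ hl =>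
    h.isReduced_of_isRotated (hr.trans hl)

/-- `Walk T a l b`: the word `l` labels a walk from `a` to `b` for the step relation `T`. -/
def Walk {Q A : Type} (T : Q → A → Q → Prop) : Q → List A → Q → Prop
  | a, [], b => a = b
  | a, y :: l, b => ∃ c, T a y c ∧ Walk T c l b

/-- A deterministic step relation in which formally inverse letters act inversely. -/
structure IsInverseAutomaton {Q X : Type} (T : Q → X × Bool → Q → Prop) : Prop where
  symm : ∀ {a b x s}, T a (x, s) b → T b (x, !s) a
  det : ∀ {a y b c}, T a y b → T a y c → b = c

section Walk

variable {Q : Type}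

theorem walk_append {A : Type} {T : Q → A → Q → Prop} {l₁ l₂ : List A} {a b : Q} :
    Walk T a (l₁ ++ l₂) b ↔ ∃ c, Walk T a l₁ c ∧ Walk T c l₂ b := by
  induction l₁ generalizing a with
  | nil => simp [Walk]
  | cons y l ih =>
    simp only [List.cons_append, Walk, ih]
    constructor
    · rintro ⟨c, h1, d, h2, h3⟩; exact ⟨d, ⟨c, h1, h2⟩, h3⟩
    · rintro ⟨d, ⟨c, h1, h2⟩, h3⟩; exact ⟨c, h1, d, h2, h3⟩

theorem walk_singleton {A : Type} {T : Q → A → Q → Prop} {y : A} {a b : Q} :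
    Walk T a [y] b ↔ T a y b := by
  simp [Walk]

variable {X : Type} {T : Q → X × Bool → Q → Prop}

namespace IsInverseAutomaton

theorem walk_det (hT : IsInverseAutomaton T) {l : List (X × Bool)} {a b c : Q}
    (h : Walk T a l b) (h' : Walk T a l c) : b = c := by
  induction l generalizing a with
  | nil => exact h.symm.trans h'
  | cons y l ih =>
    obtain ⟨d, h1, h2⟩ := h
    obtain ⟨d', h1', h2'⟩ := h'
    cases hT.det h1 h1'
    exact ih h2 h2'

theorem walk_invRev (hT : IsInverseAutomaton T) {l : List (X × Bool)} {a b : Q}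
    (h : Walk T a l b) : Walk T b (FreeGroup.invRev l) a := by
  induction l generalizing a with
  | nil => exact Eq.symm h
  | cons y l ih =>
    obtain ⟨d, h1, h2⟩ := h
    rw [FreeGroup.invRev_cons, walk_append]
    exact ⟨d, ih h2, walk_singleton.2 (hT.symm h1)⟩

theorem walk_det_left (hT : IsInverseAutomaton T) {l : List (X × Bool)} {a b c : Q}
    (h : Walk T a l c) (h' : Walk T b l c) : a = b :=
  hT.walk_det (hT.walk_invRev h) (hT.walk_invRev h')

theorem walk_red (hT : IsInverseAutomaton T) {l l' : List (X × Bool)} {a b : Q} (h : Walk T a l b)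
    (hr : FreeGroup.Red l l') : Walk T a l' b := by
  induction hr with
  | refl => exact h
  | tail _ hs ih =>
    obtain ⟨l₁, l₂, x, s⟩ := hs
    obtain ⟨c, h1, d, h2, e, h3, h4⟩ := walk_append.1 ih
    cases hT.det (hT.symm h2) h3
    exact walk_append.2 ⟨c, h1, h4⟩

/-- Membership in a subgroup whose generators label closed walks at `a` is witnessed by closed
walks at `a`. -/
theorem walk_toWord_of_mem_closure (hT : IsInverseAutomaton T) [DecidableEq X]
    {s : Set (FreeGroup X)} {a : Q}
    (hs : ∀ g ∈ s, Walk T a g.toWord a) {g : FreeGroup X} (hg : g ∈ Subgroup.closure s) :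
    Walk T a g.toWord a := by
  induction hg using Subgroup.closure_induction with
  | mem g hg => exact hs g hg
  | one => simp [Walk]
  | mul x y _ _ hx hy =>
    rw [FreeGroup.toWord_mul]
    exact hT.walk_red (walk_append.2 ⟨a, hx, hy⟩) FreeGroup.reduce.red
  | inv x _ hx =>
    rw [FreeGroup.toWord_inv]
    exact hT.walk_invRev hx

theorem exists_walk_of_conj_mem (hT : IsInverseAutomaton T) [DecidableEq X]
    {H : Subgroup (FreeGroup X)} {a : Q}
    (hH : ∀ g ∈ H, Walk T a g.toWord a) (c : List (X × Bool)) :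
    ∀ l : List (X × Bool), FreeGroup.IsReduced c → FreeGroup.IsCyclicallyReduced l →
      FreeGroup.mk c * FreeGroup.mk l * (FreeGroup.mk c)⁻¹ ∈ H → ∃ b, Walk T b l b := by
  induction c using List.reverseRecOn with
  | nil =>
    intro l _ hl hm
    refine ⟨a, ?_⟩
    have := hH _ hm
    rw [show (FreeGroup.mk [] : FreeGroup X) = 1 from rfl] at this
    simpa [FreeGroup.toWord_mk, hl.isReduced.reduce_eq] using this
  | append_singleton c x ih =>
    intro l hc hl hm
    have hc' : FreeGroup.IsReduced c := hc.infix ⟨[], [x], by simp⟩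
    have hx : FreeGroup.mk [x] * FreeGroup.mk [(x.1, !x.2)] = 1 := by
      simp [FreeGroup.mul_mk, ← FreeGroup.toWord_inj, FreeGroup.toWord_mk, FreeGroup.reduce.cons]
    have hxi : FreeGroup.mk [(x.1, !x.2)] = (FreeGroup.mk [x])⁻¹ := eq_inv_of_mul_eq_one_right hx
    have rot : ∀ l₁ l₂ : List (X × Bool), (∃ b, Walk T b (l₁ ++ l₂) b) →
        ∃ b, Walk T b (l₂ ++ l₁) b := by
      rintro l₁ l₂ ⟨b, hb⟩
      obtain ⟨d, h1, h2⟩ := walk_append.1 hb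
      exact ⟨d, walk_append.2 ⟨b, h2, h1⟩⟩
    rcases l with _ | ⟨y, t⟩
    · exact ⟨a, rfl⟩
    by_cases hy : y = (x.1, !x.2)
    · refine rot t [y] (ih _ hc' (hl.of_isRotated ⟨1, by simp⟩) ?_)
      rw [hy, show (x.1, !x.2) :: t = [(x.1, !x.2)] ++ t from rfl] at hm
      rw [hy]
      convert hm using 1
      simp only [← FreeGroup.mul_mk, hxi]
      group
    by_cases hz : ∃ t', y :: t = t' ++ [x]
    · obtain ⟨t', ht'⟩ := hz
      rw [ht'] at hm hl ⊢
      refine rot [x] t' (ih _ hc' (hl.of_isRotated List.isRotated_append) ?_)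
      convert hm using 1
      simp only [← FreeGroup.mul_mk]
      group
    have hred : FreeGroup.IsReduced ((c ++ [x]) ++ (y :: t) ++ FreeGroup.invRev (c ++ [x])) := by
      have hlast : ∃ z t', y :: t = t' ++ [z] :=
        ⟨_, _, (List.dropLast_append_getLast (List.cons_ne_nil y t)).symm⟩
      have h1 : FreeGroup.IsReduced ((c ++ [x]) ++ (y :: t)) := by
        refine List.IsChain.append hc hl.isReduced ?_
        rintro p hp q hq hpq
        simp only [List.getLast?_append, List.getLast?_singleton, Option.some_or, Option.mem_def,
          Option.some.injEq, List.head?_cons] at hp hq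
        subst hp hq
        by_contra hne
        exact hy (Prod.ext hpq.symm (by
          revert hne; cases x.2 <;> cases y.2 <;> simp))
      refine List.IsChain.append h1 ?_ ?_
      · have : FreeGroup.IsReduced (FreeGroup.invRev (c ++ [x])) := by
          rw [FreeGroup.isReduced_iff_reduce_eq, FreeGroup.reduce_invRev, hc.reduce_eq]
        exact this
      · obtain ⟨z, t', ht'⟩ := hlast
        have hzx : z ≠ x := by
          rintro rfl
          exact hz ⟨t', ht'⟩
        rw [ht']
        rintro p hp q hq hpq
        simp only [← List.append_assoc, List.getLast?_concat, Option.mem_def,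
          Option.some.injEq] at hp
        simp [FreeGroup.invRev] at hq
        subst hp hq
        by_contra hne
        exact hzx (Prod.ext hpq (by
          revert hne; cases x.2 <;> cases z.2 <;> simp))
    have hw := hH _ hm
    rw [FreeGroup.inv_mk, FreeGroup.mul_mk, FreeGroup.mul_mk, FreeGroup.toWord_mk,
      hred.reduce_eq] at hw
    obtain ⟨d, hw1, hw2⟩ := walk_append.1 hw
    obtain ⟨b, hw3, hw4⟩ := walk_append.1 hw1
    have := hT.walk_invRev hw2
    rw [FreeGroup.invRev_invRev] at this
    obtain rfl := hT.walk_det hw3 this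
    exact ⟨_, hw4⟩

end IsInverseAutomaton

end Walk

namespace XDigraph

variable {X : Type} (S : XDigraph X)

/-- The step relation of an `X`-digraph on its vertices. -/
def Step (a : S.V) (y : X × Bool) (b : S.V) : Prop :=
  ∃ d : S.Dart, S.dInit d = a ∧ S.dLab d = y ∧ S.dTerm d = b

/-- Two darts that may follow each other in an immersed path. -/
def Next (d d' : S.Dart) : Prop := S.dTerm d = S.dInit d' ∧ d' ≠ S.dRev d

variable {S}

@[simp]
theorem dInit_dRev (d : S.Dart) : S.dInit (S.dRev d) = S.dTerm d := by
  rcases d with ⟨e, _ | _⟩ <;> rfl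

@[simp]
theorem dTerm_dRev (d : S.Dart) : S.dTerm (S.dRev d) = S.dInit d := by
  rcases d with ⟨e, _ | _⟩ <;> rfl

@[simp]
theorem dRev_dRev (d : S.Dart) : S.dRev (S.dRev d) = d := by
  rcases d with ⟨e, _ | _⟩ <;> rfl

theorem dRev_injective : Function.Injective S.dRev := Function.LeftInverse.injective dRev_dRev

theorem Folded.isInverseAutomaton (hF : S.Folded) : IsInverseAutomaton S.Step where
  symm := by
    rintro a b x s ⟨d, rfl, hl, rfl⟩
    obtain ⟨h1, h2⟩ := Prod.ext_iff.1 hl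
    simp only [dLab] at h1 h2
    exact ⟨S.dRev d, dInit_dRev d, by simp [dLab, dRev, h1, h2], dTerm_dRev d⟩
  det := by
    rintro a y b c ⟨d, h1, h2, rfl⟩ ⟨d', h1', h2', rfl⟩
    have : S.dRev d = S.dRev d' := by
      refine hF a (by simpa using h1) (by simpa using h1') ?_
      have := h2.trans h2'.symm
      simp only [dLab, Prod.mk.injEq] at this
      simp [dLab, dRev, this.1, this.2]
    rw [dRev_injective this]

theorem Folded.dart_ext_of_dInit (hF : S.Folded) {d d' : S.Dart} (h : S.dInit d = S.dInit d')
    (hl : S.dLab d = S.dLab d') : d = d' := by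
  apply dRev_injective
  refine hF (S.dInit d) (by simp) (by simp [h]) ?_
  simp only [dLab, Prod.mk.injEq] at hl
  simp [dLab, dRev, hl.1, hl.2]

theorem NoLeaf.two_le_degree (hL : S.NoLeaf) (d : S.Dart) : 2 ≤ S.degree (S.dTerm d) := by
  have h1 : 0 < S.degree (S.dTerm d) := Finset.card_pos.2 ⟨d, by simp⟩
  have := hL (S.dTerm d)
  omega

theorem card_dInit_eq_degree (x : S.V) :
    (Finset.univ.filter (fun d : S.Dart => S.dInit d = x)).card = S.degree x := by
  refine Finset.card_bij' (fun d _ => S.dRev d) (fun d _ => S.dRev d) ?_ ?_ ?_ ?_ <;> simp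

theorem NoLeaf.exists_next (hL : S.NoLeaf) (d : S.Dart) : ∃ d', S.Next d d' := by
  have h := hL.two_le_degree d
  rw [← card_dInit_eq_degree] at h
  obtain ⟨d', h1, h2⟩ := Finset.exists_mem_ne h (S.dRev d)
  exact ⟨d', (Finset.mem_filter.1 h1).2.symm, h2⟩

/-- In a graph without leaves, a set of darts closed under successors contains at least as many
outgoing as incoming darts at every vertex. -/
theorem NoLeaf.card_in_le_card_out (hL : S.NoLeaf) {R : Finset S.Dart}
    (hR : ∀ d ∈ R, ∀ d', S.Next d d' → d' ∈ R) (x : S.V) :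
    (R.filter (fun d => S.dTerm d = x)).card ≤ (R.filter (fun d => S.dInit d = x)).card := by
  rcases (R.filter (fun d => S.dTerm d = x)).eq_empty_or_nonempty with h0 | ⟨i, hi⟩
  · simp [h0]
  obtain ⟨hiR, rfl⟩ := Finset.mem_filter.1 hi
  rcases le_or_gt (R.filter (fun d => S.dTerm d = S.dTerm i)).card 1 with h1 | h1
  · obtain ⟨d', hd'⟩ := hL.exists_next i
    exact h1.trans (Finset.card_pos.2 ⟨d', by simp [hR i hiR d' hd', hd'.1]⟩)
  · refine Finset.card_le_card_of_injOn S.dRev ?_ dRev_injective.injOn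
    intro d hd
    obtain ⟨j, hj, hjd⟩ := Finset.exists_mem_ne h1 d
    have hd := Finset.mem_filter.1 (Finset.mem_coe.1 hd)
    obtain ⟨hj, hjx⟩ := Finset.mem_filter.1 hj
    refine Finset.mem_coe.2 (Finset.mem_filter.2 ⟨hR j hj _ ⟨?_, ?_⟩, ?_⟩)
    · simp [hjx, hd.2]
    · exact fun h => hjd (dRev_injective h).symm
    · simp [hd.2]

theorem NoLeaf.mem_of_next (hL : S.NoLeaf) {R : Finset S.Dart}
    (hR : ∀ d ∈ R, ∀ d', S.Next d d' → d' ∈ R) {d d' : S.Dart} (hd : S.Next d d')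
    (hd' : d' ∈ R) : d ∈ R := by
  have hle := hL.card_in_le_card_out hR
  have hsum : ∑ x, (R.filter (fun d => S.dTerm d = x)).card =
      ∑ x, (R.filter (fun d => S.dInit d = x)).card := by
    rw [← Finset.card_eq_sum_card_fiberwise (fun _ _ => Finset.mem_coe.2 (Finset.mem_univ _)),
      ← Finset.card_eq_sum_card_fiberwise (fun _ _ => Finset.mem_coe.2 (Finset.mem_univ _))]
  have heq := (Finset.sum_eq_sum_iff_of_le fun x _ => hle x).1 hsum (S.dTerm d)
    (Finset.mem_univ _)
  have hd'O : d' ∈ R.filter (fun d₁ => S.dInit d₁ = S.dTerm d) := by simp [hd', hd.1]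
  by_contra hdR
  have hrev : ∀ i ∈ R.filter (fun d₁ => S.dTerm d₁ = S.dTerm d),
      S.dRev d ∈ R.filter (fun d₁ => S.dInit d₁ = S.dTerm d) := by
    intro i hi
    obtain ⟨hi, hix⟩ := Finset.mem_filter.1 hi
    refine Finset.mem_filter.2 ⟨hR i hi _ ⟨by simp [hix], fun h => ?_⟩, by simp⟩
    exact hdR (dRev_injective h ▸ hi)
  obtain ⟨i, hi⟩ : (R.filter (fun d₁ => S.dTerm d₁ = S.dTerm d)).Nonempty := by
    rw [← Finset.card_pos, heq]
    exact Finset.card_pos.2 ⟨d', hd'O⟩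
  have h2 : 1 < (R.filter (fun d₁ => S.dInit d₁ = S.dTerm d)).card :=
    Finset.one_lt_card.2 ⟨d', hd'O, S.dRev d, hrev i hi, hd.2⟩
  rw [← heq] at h2
  have hall : R.filter (fun d₁ => S.dInit d₁ = S.dTerm d) =
      Finset.univ.filter (fun d₁ : S.Dart => S.dInit d₁ = S.dTerm d) := by
    refine Finset.Subset.antisymm (Finset.filter_subset_filter _ (Finset.subset_univ _)) ?_
    intro o ho
    have ho := (Finset.mem_filter.1 ho).2
    obtain ⟨j, hj, hjo⟩ := Finset.exists_mem_ne h2 (S.dRev o)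
    obtain ⟨hj, hjx⟩ := Finset.mem_filter.1 hj
    refine Finset.mem_filter.2 ⟨hR j hj _ ⟨by simp [hjx, ho], fun h => hjo ?_⟩, ho⟩
    rw [h, dRev_dRev]
  rw [hall, card_dInit_eq_degree, degree] at heq
  have hsub := Finset.eq_of_subset_of_card_le
    (Finset.filter_subset_filter (fun d₁ => S.dTerm d₁ = S.dTerm d) (Finset.subset_univ R)) heq.ge
  have : d ∈ R.filter (fun d₁ => S.dTerm d₁ = S.dTerm d) := by rw [hsub]; simp
  exact hdR (Finset.mem_filter.1 this).1

theorem NoLeaf.reflTransGen_next_symm (hL : S.NoLeaf) {d d' : S.Dart}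
    (h : Relation.ReflTransGen S.Next d d') : Relation.ReflTransGen S.Next d' d := by
  classical
  induction h with
  | refl => exact .refl
  | @tail b c _ hbc ih =>
    refine Relation.ReflTransGen.trans ?_ ih
    have := hL.mem_of_next (R := Finset.univ.filter (Relation.ReflTransGen S.Next c))
      (fun d hd d' hdd' => by simpa using (Finset.mem_filter.1 hd).2.tail hdd') hbc
      (by simpa using Relation.ReflTransGen.refl)
    simpa using this

theorem NoLeaf.exists_cyclic_extension (hL : S.NoLeaf) (d : S.Dart) (p : List S.Dart)
    (hp : (d :: p).IsChain S.Next) : ∃ m, (d :: p ++ m ++ [d]).IsChain S.Next := by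
  obtain ⟨q, e, hqe⟩ : ∃ q e, d :: p = q ++ [e] :=
    ⟨_, _, (List.dropLast_append_getLast (List.cons_ne_nil d p)).symm⟩
  have hreach : Relation.ReflTransGen S.Next d e := by
    have := List.relationReflTransGen_of_exists_isChain_cons p hp
      (List.getLast_congr (List.cons_ne_nil d p) (by simp) hqe)
    simpa using this
  obtain ⟨f, hf⟩ := hL.exists_next e
  obtain ⟨l, hl, hlast⟩ := List.exists_isChain_cons_of_relationReflTransGen
    (hL.reflTransGen_next_symm (hreach.tail hf))
  refine ⟨(f :: l).dropLast, ?_⟩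
  have h1 : (f :: l).dropLast ++ [d] = f :: l := by
    conv_rhs => rw [← List.dropLast_append_getLast (List.cons_ne_nil f l), hlast]
  rw [List.append_assoc, h1, hqe]
  rw [hqe] at hp
  refine List.IsChain.append hp hl ?_
  simpa using hf

theorem Folded.isReduced_of_isChain_next (hF : S.Folded) {p : List S.Dart}
    (hp : p.IsChain S.Next) : FreeGroup.IsReduced (p.map S.dLab) := by
  refine (List.isChain_map _).2 (hp.imp fun d d' hd h1 => ?_)
  by_contra h2
  refine hd.2 (hF.dart_ext_of_dInit (by simp [hd.1]) ?_)
  simp only [dLab] at h1 h2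
  simp only [dLab, dRev, Prod.mk.injEq]
  exact ⟨h1.symm, by revert h2; cases d.2 <;> cases d'.2 <;> simp⟩

theorem IsPath.walk {d : S.Dart} {p : List S.Dart}
    (hp : (d :: p).IsChain (fun d d' => S.dTerm d = S.dInit d')) :
    Walk S.Step (S.dInit d) ((d :: p).map S.dLab)
      (S.dTerm ((d :: p).getLast (List.cons_ne_nil d p))) := by
  induction p generalizing d with
  | nil => exact ⟨_, ⟨d, rfl, rfl, rfl⟩, rfl⟩
  | cons e p ih =>
    rw [List.isChain_cons_cons] at hp
    refine ⟨_, ⟨d, rfl, rfl, rfl⟩, ?_⟩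
    rw [hp.1, List.getLast_cons (List.cons_ne_nil e p)]
    exact ih hp.2

theorem exists_isChain_next_of_walk {l : List (X × Bool)} {a b : S.V} (hw : Walk S.Step a l b)
    (hl : FreeGroup.IsReduced l) (hne : l ≠ []) :
    ∃ d p, (d :: p).IsChain S.Next ∧ (d :: p).map S.dLab = l ∧ S.dInit d = a := by
  induction l generalizing a with
  | nil => exact absurd rfl hne
  | cons y l ih =>
    obtain ⟨c, ⟨d, h1, h2, h3⟩, hw⟩ := hw
    rcases l with _ | ⟨z, l⟩
    · exact ⟨d, [], by simp, by simpa using h2, h1⟩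
    · obtain ⟨e, p, he, hmap, hinit⟩ := ih hw (List.isChain_cons_cons.1 hl).2 (by simp)
      refine ⟨d, e :: p, List.isChain_cons_cons.2 ⟨⟨h3.trans hinit.symm, ?_⟩, he⟩, ?_, h1⟩
      · rintro rfl
        have hz : S.dLab (S.dRev d) = z := (List.cons.inj hmap).1
        have := (List.isChain_cons_cons.1 hl).1
        rw [← h2, ← hz] at this
        simp [dLab, dRev] at this
      · rw [List.map_cons, hmap, h2]

theorem walk_of_reads [DecidableEq X] {a : S.V} {w : FreeGroup X} (h : Reads S a w) :
    Walk S.Step a w.toWord a := by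
  obtain ⟨p, -, ⟨hp, hends⟩, hlab⟩ := h
  rcases p with _ | ⟨d, p⟩
  · rw [← hlab]; exact rfl
  · have := IsPath.walk hp
    obtain ⟨h1, h2⟩ := hends (List.cons_ne_nil d p)
    rw [h2, show S.dInit d = a from h1] at this
    rw [← hlab]
    exact this

end XDigraph

section CRep

open XDigraph

variable {X : Type} [DecidableEq X] {S : XDigraph X} {H : Subgroup (FreeGroup X)}

theorem CRep.exists_walk (hS : CRep S H) {l : List (X × Bool)}
    (hl : FreeGroup.IsCyclicallyReduced l) (hm : FreeGroup.mk l ∈ H) :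
    ∃ a, Walk S.Step a l a := by
  have hw : (FreeGroup.mk l).toWord = l := by rw [FreeGroup.toWord_mk, hl.isReduced.reduce_eq]
  obtain ⟨a, ha⟩ := (hS.2.2.2 (FreeGroup.mk l)
    (cyclRed_iff_isCyclicallyReduced.2 (hw.symm ▸ hl))).2 ⟨1, by simpa using hm⟩
  exact ⟨a, hw ▸ walk_of_reads ha⟩

/-- Every reduced word readable in the Stallings graph is readable in any automaton in which the
elements of the subgroup are readable. -/
theorem CRep.exists_walk_of_walk (hS : CRep S H) {Q : Type} {T : Q → X × Bool → Q → Prop}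
    (hT : IsInverseAutomaton T) {s : Q} (hH : ∀ g ∈ H, Walk T s g.toWord s)
    {l : List (X × Bool)} {a b : S.V} (hw : Walk S.Step a l b) (hl : FreeGroup.IsReduced l) :
    ∃ t t', Walk T t l t' := by
  rcases eq_or_ne l [] with rfl | hne
  · exact ⟨s, s, rfl⟩
  obtain ⟨d, p, hp, rfl, rfl⟩ := exists_isChain_next_of_walk hw hl hne
  obtain ⟨m, hm⟩ := hS.2.2.1.exists_cyclic_extension d p hp
  have hq : (d :: (p ++ m)).IsChain S.Next := hm.infix ⟨[], [d], by simp⟩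
  have hlast := (List.isChain_append.1 hm).2.2
  have hcyc : FreeGroup.IsCyclicallyReduced ((d :: (p ++ m)).map S.dLab) := by
    refine ⟨hS.1.isReduced_of_isChain_next hq, ?_⟩
    have h3 := hS.1.isReduced_of_isChain_next hm
    rw [List.map_append] at h3
    simpa using (List.isChain_append.1 h3).2.2
  have hword : (FreeGroup.mk ((d :: (p ++ m)).map S.dLab)).toWord = (d :: (p ++ m)).map S.dLab := by
    rw [FreeGroup.toWord_mk, hcyc.isReduced.reduce_eq]
  obtain ⟨c, hc⟩ := (hS.2.2.2 _ (cyclRed_iff_isCyclicallyReduced.2 (hword.symm ▸ hcyc))).1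
    ⟨S.dInit d, d :: (p ++ m), hq.imp fun _ _ h => h.2, ⟨hq.imp fun _ _ h => h.1, fun h =>
      ⟨rfl, (hlast _ (by simpa using List.getLast?_eq_getLast_of_ne_nil h) d (by simp)).1⟩⟩,
      hword.symm⟩
  rw [← FreeGroup.mk_toWord (x := c)] at hc
  obtain ⟨t, ht⟩ := hT.exists_walk_of_conj_mem hH _ _ FreeGroup.isReduced_toWord hcyc hc
  rw [← List.cons_append, List.map_append] at ht
  obtain ⟨t', h1, -⟩ := walk_append.1 ht
  exact ⟨t, t', h1⟩

end CRep

theorem exists_perm_extending {Ω : Type} [Finite Ω] {r : Ω → Ω → Prop}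
    (hdet : ∀ {a b c}, r a b → r a c → b = c) (hinj : ∀ {a b c}, r a c → r b c → a = b) :
    ∃ σ : Equiv.Perm Ω, ∀ a b, r a b → σ a = b := by
  classical
  let e : {a // ∃ b, r a b} ≃ {b // ∃ a, r a b} :=
    { toFun := fun a => ⟨a.2.choose, a, a.2.choose_spec⟩
      invFun := fun b => ⟨b.2.choose, b, b.2.choose_spec⟩
      left_inv := fun a => Subtype.ext
        (hinj (Exists.choose_spec (p := fun a' => r a' a.2.choose) ⟨a, a.2.choose_spec⟩)
          a.2.choose_spec)
      right_inv := fun b => Subtype.ext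
        (hdet (Exists.choose_spec (p := fun b' => r b.2.choose b') ⟨b, b.2.choose_spec⟩)
          b.2.choose_spec) }
  cases nonempty_fintype Ω
  refine ⟨e.extendSubtype, fun a b hab => ?_⟩
  rw [e.extendSubtype_apply_of_mem a ⟨b, hab⟩]
  exact hdet (Exists.choose_spec (p := fun b' => r a b') ⟨b, hab⟩) hab

/-- A transitive permutation group on a finite set, all of whose elements have fixed points,
acts on a set with at most one element. -/
theorem subsingleton_of_forall_exists_fixed {G Ω : Type} [Group G] [Finite G] [Finite Ω]
    [MulAction G Ω] [MulAction.IsPretransitive G Ω] (hfix : ∀ g : G, ∃ a : Ω, g • a = a) :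
    Subsingleton Ω := by
  classical
  cases nonempty_fintype G
  cases nonempty_fintype Ω
  have hB := MulAction.sum_card_fixedBy_eq_card_orbits_mul_card_group G Ω
  have horb : Fintype.card (Quotient (MulAction.orbitRel G Ω)) = 1 := by
    obtain ⟨a, -⟩ := hfix 1
    rw [Fintype.card_eq_one_iff]
    refine ⟨Quotient.mk'' a, fun b => ?_⟩
    induction b using Quotient.inductionOn' with
    | h b => exact Quotient.sound' (MulAction.exists_smul_eq G a b)
  rw [horb, one_mul] at hB
  have hge : ∀ g : G, 1 ≤ Fintype.card (MulAction.fixedBy Ω g) := fun g =>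
    Fintype.card_pos_iff.2 ⟨⟨(hfix g).choose, (hfix g).choose_spec⟩⟩
  have h1 : ∑ g : G, 1 = ∑ g : G, Fintype.card (MulAction.fixedBy Ω g) := by
    rw [hB, Finset.sum_const, smul_eq_mul, mul_one, Finset.card_univ]
  have h2 := (Finset.sum_eq_sum_iff_of_le fun g _ => hge g).1 h1 1 (Finset.mem_univ _)
  rw [← Fintype.card_le_one_iff_subsingleton, h2]
  exact Fintype.card_le_of_injective (fun a => ⟨a, one_smul G a⟩)
    fun a b h => congrArg Subtype.val h

/-- A transitive system of partial injections of a finite set, closed under inverses, in which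
every composite has a fixed point, lives on a set with at most one element. -/
theorem subsingleton_of_forall_exists_closed_walk {Ω I : Type} [Finite Ω] {R : Ω → I → Ω → Prop}
    (hdet : ∀ {a i b c}, R a i b → R a i c → b = c)
    (hinj : ∀ {a i b c}, R a i c → R b i c → a = b)
    (htrans : ∀ a b, ∃ L, Walk R a L b) (hfix : ∀ L, ∃ a, Walk R a L a) : Subsingleton Ω := by
  classical
  have hwdet : ∀ {L a b c}, Walk R a L b → Walk R a L c → b = c := by
    intro L
    induction L with
    | nil => exact fun h h' => h.symm.trans h'
    | cons i L ih =>
      rintro a b c ⟨d, h1, h2⟩ ⟨d', h1', h2'⟩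
      obtain rfl := hdet h1 h1'
      exact ih h2 h2'
  by_cases htot : ∀ a i, ∃ b, R a i b
  · choose f hf using htot
    have hbij : ∀ i, Function.Bijective fun a => f a i := fun i =>
      Finite.injective_iff_bijective.1 fun a b (hab : f a i = f b i) =>
        hinj (hf a i) (hab ▸ hf b i)
    let σ : I → Equiv.Perm Ω := fun i => Equiv.ofBijective _ (hbij i)
    have hσ : ∀ a i, R a i (σ i a) := fun a i => hf a i
    let G := Subgroup.closure (Set.range σ)
    have hG : ∀ g ∈ G, ∃ L, ∀ a, Walk R a L (g a) := by
      intro g hg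
      rw [← Subgroup.mem_toSubmonoid, Subgroup.closure_toSubmonoid_of_finite] at hg
      induction hg using Submonoid.closure_induction with
      | mem g hg =>
        obtain ⟨i, rfl⟩ := hg
        exact ⟨[i], fun a => walk_singleton.2 (hσ a i)⟩
      | one => exact ⟨[], fun a => rfl⟩
      | mul x y _ _ hx hy =>
        obtain ⟨L, hL⟩ := hx
        obtain ⟨L', hL'⟩ := hy
        exact ⟨L' ++ L, fun a => walk_append.2 ⟨_, hL' a, hL _⟩⟩
    have : MulAction.IsPretransitive G Ω := by
      refine ⟨fun a b => ?_⟩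
      obtain ⟨L, hL⟩ := htrans a b
      induction L generalizing a with
      | nil => exact ⟨1, by rw [one_smul]; exact hL⟩
      | cons i L ih =>
        obtain ⟨c, h1, h2⟩ := hL
        obtain ⟨g, hg⟩ := ih c h2
        refine ⟨g * ⟨σ i, Subgroup.subset_closure ⟨i, rfl⟩⟩, ?_⟩
        rw [mul_smul, ← hg, hdet h1 (hσ a i)]
        rfl
    refine subsingleton_of_forall_exists_fixed (G := G) fun g => ?_
    obtain ⟨L, hL⟩ := hG g g.2
    obtain ⟨a, ha⟩ := hfix L
    exact ⟨a, hwdet (hL a) ha⟩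
  · push Not at htot
    obtain ⟨a₀, i₀, h₀⟩ := htot
    exfalso
    have hkill : ∀ n, ∀ L, Set.ncard {a | ∃ b, Walk R a L b} = n → False := by
      intro n
      induction n using Nat.strong_induction_on with
      | _ n ih =>
        rintro L rfl
        obtain ⟨a, ha⟩ := hfix L
        obtain ⟨L', hL'⟩ := htrans a a₀
        refine ih _ (Set.ncard_lt_ncard ?_ (Set.toFinite _)) (L ++ (L' ++ [i₀])) rfl
        refine ⟨?_, fun hsub => ?_⟩
        · rintro b ⟨c, hc⟩
          obtain ⟨d, hd, -⟩ := walk_append.1 hc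
          exact ⟨d, hd⟩
        · obtain ⟨c, hc⟩ := hsub (show a ∈ {a | ∃ b, Walk R a L b} from ⟨a, ha⟩)
          obtain ⟨d, hd, h1⟩ := walk_append.1 hc
          obtain ⟨e, he, h2⟩ := walk_append.1 h1
          obtain rfl := hwdet ha hd
          obtain rfl := hwdet hL' he
          exact h₀ c (walk_singleton.1 h2)
    exact hkill _ [] rfl

/-- The automaton consisting of a rose at the state `none`, with petals labeled by all letters but
`v`, a `v`-edge from `some o` to `none`, and cycles given by the permutation `σ` with edge
labels `lab`. -/
inductive LoopStep {X C : Type} (v : X) (σ : Equiv.Perm C) (lab : C → X × Bool) (o : C) :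
    Option C → X × Bool → Option C → Prop
  | rose (x : X) (s : Bool) (h : x ≠ v) : LoopStep v σ lab o none (x, s) none
  | down : LoopStep v σ lab o none (v, false) (some o)
  | up : LoopStep v σ lab o (some o) (v, true) none
  | fwd (i : C) : LoopStep v σ lab o (some i) (lab i) (some (σ i))
  | bwd (i : C) : LoopStep v σ lab o (some (σ i)) ((lab i).1, !(lab i).2) (some i)

namespace LoopStep

variable {X C : Type} {v : X} {σ : Equiv.Perm C} {lab : C → X × Bool} {o : C}

theorem eq_or_of_some {i : C} {y : X × Bool} {t : Option C} (h : LoopStep v σ lab o (some i) y t) :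
    (i = o ∧ y = (v, true) ∧ t = none) ∨ (y = lab i ∧ t = some (σ i)) ∨
      (y = ((lab (σ.symm i)).1, !(lab (σ.symm i)).2) ∧ t = some (σ.symm i)) := by
  generalize hi : some i = s at h
  cases h with
  | rose => cases hi
  | down => cases hi
  | up => cases hi; exact .inl ⟨rfl, rfl, rfl⟩
  | fwd j => cases hi; exact .inr (.inl ⟨rfl, rfl⟩)
  | bwd j =>
    obtain rfl := Option.some.inj hi
    refine .inr (.inr ?_)
    rw [Equiv.symm_apply_apply]
    exact ⟨rfl, rfl⟩

theorem eq_or_of_none {y : X × Bool} {t : Option C} (h : LoopStep v σ lab o none y t) :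
    (y.1 ≠ v ∧ t = none) ∨ (y = (v, false) ∧ t = some o) := by
  generalize hi : none = s at h
  cases h with
  | rose _ _ h => exact .inl ⟨h, rfl⟩
  | down => exact .inr ⟨rfl, rfl⟩
  | up => cases hi
  | fwd => cases hi
  | bwd => cases hi

theorem isInverseAutomaton (hv : ∀ i, (lab i).1 ≠ v)
    (hred : ∀ i, lab (σ i) ≠ ((lab i).1, !(lab i).2)) :
    IsInverseAutomaton (LoopStep v σ lab o) where
  symm := by
    intro a b x s h
    generalize hy : (x, s) = y at h
    cases h with
    | rose x' s' h => cases hy; exact .rose x _ h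
    | down => cases hy; exact .up
    | up => cases hy; exact .down
    | fwd i =>
      have := bwd (v := v) (σ := σ) (lab := lab) (o := o) i
      rwa [← hy] at this
    | bwd i =>
      cases hy
      simpa using fwd (v := v) (σ := σ) (lab := lab) (o := o) i
  det := by
    intro a y b c hb hc
    rcases a with _ | i
    · rcases eq_or_of_none hb with ⟨h1, rfl⟩ | ⟨rfl, rfl⟩ <;>
      rcases eq_or_of_none hc with ⟨h2, rfl⟩ | ⟨h2, rfl⟩
      · rfl
      · exact absurd (congrArg Prod.fst h2) h1
      · exact absurd rfl h2
      · rfl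
    · have h' := hred (σ.symm i)
      rw [Equiv.apply_symm_apply] at h'
      have e1 := hv i
      have e2 := hv (σ.symm i)
      rcases eq_or_of_some hb with ⟨-, h1, rfl⟩ | ⟨h1, rfl⟩ | ⟨h1, rfl⟩ <;>
      rcases eq_or_of_some hc with ⟨-, h2, rfl⟩ | ⟨h2, rfl⟩ | ⟨h2, rfl⟩ <;>
      first
      | rfl
      | exact absurd (h1.symm.trans h2) h'
      | exact absurd (h2.symm.trans h1) h'
      | exact absurd (congrArg Prod.fst (h1.symm.trans h2)).symm e1
      | exact absurd (congrArg Prod.fst (h1.symm.trans h2)) e1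
      | exact absurd (congrArg Prod.fst (h1.symm.trans h2)).symm e2
      | exact absurd (congrArg Prod.fst (h1.symm.trans h2)) e2

theorem eq_none_of_walk {l : List (X × Bool)} {t : Option C} (hl : ∀ y ∈ l, y.1 ≠ v)
    (h : Walk (LoopStep v σ lab o) none l t) : t = none := by
  induction l with
  | nil => exact h.symm
  | cons y l ih =>
    obtain ⟨c, h1, h2⟩ := h
    rcases eq_or_of_none h1 with ⟨-, rfl⟩ | ⟨h3, -⟩
    · exact ih (fun z hz => hl z (by simp [hz])) h2
    · exact absurd (congrArg Prod.fst h3) (hl y (by simp))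

/-- Words in letters other than `v` readable along the cycles, up to powers of `u`. -/
theorem exists_some_of_walk {u : FreeGroup X} {pot : C → FreeGroup X}
    (hpot : ∀ i, pot i * FreeGroup.mk [lab i] * (pot (σ i))⁻¹ ∈ Subgroup.zpowers u)
    {l : List (X × Bool)} {i : C} {t : Option C} (hl : ∀ y ∈ l, y.1 ≠ v)
    (h : Walk (LoopStep v σ lab o) (some i) l t) :
    ∃ j, t = some j ∧ pot i * FreeGroup.mk l * (pot j)⁻¹ ∈ Subgroup.zpowers u := by
  induction l generalizing i with
  | nil =>
    refine ⟨i, h.symm, ?_⟩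
    rw [show (FreeGroup.mk [] : FreeGroup X) = 1 from rfl, mul_one, mul_inv_cancel]
    exact Subgroup.one_mem _
  | cons y l ih =>
    obtain ⟨c, h1, h2⟩ := h
    have hl' : ∀ z ∈ l, z.1 ≠ v := fun z hz => hl z (by simp [hz])
    have key : ∃ k, c = some k ∧ pot i * FreeGroup.mk [y] * (pot k)⁻¹ ∈ Subgroup.zpowers u := by
      rcases eq_or_of_some h1 with ⟨-, rfl, -⟩ | ⟨rfl, rfl⟩ | ⟨rfl, rfl⟩
      · exact absurd rfl (hl (v, true) (by simp))
      · exact ⟨_, rfl, hpot i⟩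
      · refine ⟨_, rfl, ?_⟩
        have := Subgroup.inv_mem _ (hpot (σ.symm i))
        rw [Equiv.apply_symm_apply] at this
        simpa [mul_assoc, FreeGroup.inv_mk, FreeGroup.invRev] using this
    obtain ⟨k, rfl, hk⟩ := key
    obtain ⟨j, rfl, hj⟩ := ih hl' h2
    refine ⟨j, rfl, ?_⟩
    convert Subgroup.mul_mem _ hk hj using 1
    rw [show y :: l = [y] ++ l from rfl, ← FreeGroup.mul_mk]
    group

end LoopStep

theorem mem_toWord_ne_of_mem_closure {X : Type} [DecidableEq X] {v : X} {g : FreeGroup X}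
    (hg : g ∈ Subgroup.closure (FreeGroup.of '' {x : X | x ≠ v})) : ∀ y ∈ g.toWord, y.1 ≠ v := by
  induction hg using Subgroup.closure_induction with
  | mem g hg =>
    obtain ⟨x, hx, rfl⟩ := hg
    simpa [FreeGroup.toWord_of] using hx
  | one => simp
  | mul a b _ _ ha hb =>
    intro y hy
    rcases List.mem_append.1 ((FreeGroup.toWord_mul_sublist a b).subset hy) with h | h
    exacts [ha y h, hb y h]
  | inv a _ ha =>
    intro y hy
    rw [FreeGroup.toWord_inv] at hy
    simp only [FreeGroup.invRev, List.mem_reverse, List.mem_map] at hy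
    obtain ⟨z, hz, rfl⟩ := hy
    exact ha z hz

theorem mk_mem_closure_of_forall_ne {X : Type} {v : X} {l : List (X × Bool)}
    (hl : ∀ y ∈ l, y.1 ≠ v) :
    FreeGroup.mk l ∈ Subgroup.closure (FreeGroup.of '' {x : X | x ≠ v}) := by
  induction l with
  | nil => exact Subgroup.one_mem _
  | cons y l ih =>
    rw [show y :: l = [y] ++ l from rfl, ← FreeGroup.mul_mk]
    refine Subgroup.mul_mem _ ?_ (ih fun z hz => hl z (by simp [hz]))
    have hy : FreeGroup.of y.1 ∈ Subgroup.closure (FreeGroup.of '' {x : X | x ≠ v}) :=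
      Subgroup.subset_closure ⟨y.1, hl y (by simp), rfl⟩
    obtain ⟨x, _ | _⟩ := y
    · simpa [FreeGroup.of, FreeGroup.inv_mk, FreeGroup.invRev] using Subgroup.inv_mem _ hy
    · exact hy

/-- The core automaton of `⟨U, v⁻¹uv⟩`: a rose with a `v`-edge leading to a cycle labeled `u`. -/
theorem exists_loopStep {X : Type} [DecidableEq X] {v : X} {u : FreeGroup X} (hu1 : u ≠ 1)
    (hcyc : FreeGroup.IsCyclicallyReduced u.toWord) (huv : ∀ y ∈ u.toWord, y.1 ≠ v) :
    ∃ (C : Type) (σ : Equiv.Perm C) (lab : C → X × Bool) (o : C) (pot : C → FreeGroup X),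
      (∀ i, (lab i).1 ≠ v) ∧ (∀ i, lab (σ i) ≠ ((lab i).1, !(lab i).2)) ∧
      Walk (LoopStep v σ lab o) (some o) u.toWord (some o) ∧ pot o = 1 ∧
      ∀ i, pot i * FreeGroup.mk [lab i] * (pot (σ i))⁻¹ ∈ Subgroup.zpowers u := by
  obtain ⟨m, hm⟩ : ∃ m, u.toWord.length = m + 1 := by
    refine Nat.exists_eq_succ_of_ne_zero fun h => hu1 ?_
    rwa [List.length_eq_zero_iff, FreeGroup.toWord_eq_nil_iff] at h
  have hlt : ∀ i : Fin (m + 1), i.val < u.toWord.length := fun i => by omega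
  refine ⟨Fin (m + 1), finRotate (m + 1), fun i => u.toWord[i.val]'(hlt i), 0,
    fun i => FreeGroup.mk (u.toWord.take i.val), fun i => huv _ (List.getElem_mem _), ?_, ?_, ?_,
    ?_⟩
  · intro i h
    rcases lt_or_eq_of_le (Nat.lt_succ_iff.1 i.isLt) with hi | hi
    · have h1 := List.isChain_iff_getElem.1 hcyc.1 i.val (by omega)
      have hv : (finRotate (m + 1) i).val = i.val + 1 := by
        rw [coe_finRotate_of_ne_last]
        rintro rfl
        simp at hi
      simp only [hv, Prod.ext_iff] at h
      have := h1 h.1.symm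
      rw [h.2] at this
      simp at this
    · obtain rfl : i = Fin.last m := Fin.ext hi
      simp only [finRotate_last] at h
      have h1 := hcyc.2 (u.toWord[m]'(by omega))
        (by simp [List.getLast?_eq_getElem?, hm])
        (u.toWord[0]'(by omega)) (by rw [List.head?_eq_getElem?]; simp [hm])
      simp only [Prod.ext_iff, Fin.val_last, Fin.val_zero] at h
      have := h1 h.1.symm
      rw [h.2] at this
      simp at this
  · have key : ∀ k : ℕ, k ≤ m + 1 →
        Walk (LoopStep v (finRotate (m + 1)) (fun i => u.toWord[i.val]'(hlt i)) 0)
          (some 0) (u.toWord.take k) (some (Fin.ofNat (m + 1) k)) := by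
      intro k
      induction k with
      | zero => intro _; simp [Walk]
      | succ k ih =>
        intro hk
        rw [List.take_succ_eq_append_getElem (by omega), walk_append]
        refine ⟨_, ih (by omega), walk_singleton.2 ?_⟩
        have h := LoopStep.fwd (v := v) (σ := finRotate (m + 1))
          (lab := fun i => u.toWord[i.val]'(hlt i)) (o := 0) (Fin.ofNat (m + 1) k)
        have hval : (Fin.ofNat (m + 1) k).val = k := Nat.mod_eq_of_lt (by omega)
        have hrot : finRotate (m + 1) (Fin.ofNat (m + 1) k) = Fin.ofNat (m + 1) (k + 1) := by
          rw [finRotate_apply]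
          exact Fin.ext (by simp [Fin.val_add])
        simpa only [hrot, hval] using h
    have h := key (m + 1) le_rfl
    rw [List.take_of_length_le (by omega)] at h
    simpa using h
  · rfl
  · intro i
    beta_reduce
    rw [FreeGroup.mul_mk, ← List.take_succ_eq_append_getElem (hlt i)]
    rcases lt_or_eq_of_le (Nat.lt_succ_iff.1 i.isLt) with hi | hi
    · have hv : (finRotate (m + 1) i).val = i.val + 1 := by
        rw [coe_finRotate_of_ne_last]
        rintro rfl
        simp at hi
      rw [hv, mul_inv_cancel]
      exact Subgroup.one_mem _
    · obtain rfl : i = Fin.last m := Fin.ext hi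
      rw [finRotate_last, Fin.val_last, List.take_of_length_le (by omega), FreeGroup.mk_toWord]
      change u * 1⁻¹ ∈ _
      rw [inv_one, mul_one]
      exact Subgroup.mem_zpowers u

/-- The subgroup `⟨U, v⁻¹uv⟩`, where `U` is the complement of `v` in the basis. -/
abbrev loopSubgroup {X : Type} (v : X) (u : FreeGroup X) : Subgroup (FreeGroup X) :=
  Subgroup.closure
    ((FreeGroup.of '' {x : X | x ≠ v}) ∪ {(FreeGroup.of v)⁻¹ * u * FreeGroup.of v})

theorem walk_none_of_mem_loopSubgroup {X : Type} [DecidableEq X] {v : X} {u : FreeGroup X}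
    {C : Type} {σ : Equiv.Perm C} {lab : C → X × Bool} {o : C}
    (hT : IsInverseAutomaton (LoopStep v σ lab o))
    (hu : Walk (LoopStep v σ lab o) (some o) u.toWord (some o)) :
    ∀ g ∈ loopSubgroup v u, Walk (LoopStep v σ lab o) none g.toWord none := by
  refine fun g hg => hT.walk_toWord_of_mem_closure ?_ hg
  rintro g (⟨x, hx, rfl⟩ | rfl)
  · rw [FreeGroup.toWord_of]
    exact walk_singleton.2 (.rose x true hx)
  · have hw : Walk (LoopStep v σ lab o) none ((v, false) :: (u.toWord ++ [(v, true)])) none :=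
      ⟨_, .down, walk_append.2 ⟨_, hu, walk_singleton.2 .up⟩⟩
    have he : (FreeGroup.of v)⁻¹ * u * FreeGroup.of v =
        FreeGroup.mk ((v, false) :: (u.toWord ++ [(v, true)])) := by
      rw [show (v, false) :: (u.toWord ++ [(v, true)]) =
        [(v, false)] ++ u.toWord ++ [(v, true)] from rfl, ← FreeGroup.mul_mk, ← FreeGroup.mul_mk,
        FreeGroup.mk_toWord]
      rfl
    rw [he, FreeGroup.toWord_mk]
    exact hT.walk_red hw FreeGroup.reduce.red

/-- A reduced word not involving the letter `v`. -/
def ReducedAvoiding {X : Type} (v : X) (l : List (X × Bool)) : Prop :=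
  FreeGroup.IsReduced l ∧ ∀ y ∈ l, y.1 ≠ v

namespace ReducedAvoiding

variable {X : Type} {v : X} {l : List (X × Bool)}

theorem cons_isReduced (h : ReducedAvoiding v l) (s : Bool) :
    FreeGroup.IsReduced ((v, s) :: l) :=
  List.IsChain.cons h.1 fun y hy hyv => absurd hyv.symm (h.2 y (List.mem_of_mem_head? hy))

theorem cons_concat_isReduced (h : ReducedAvoiding v l) {s s' : Bool} (hs : l = [] → s = s') :
    FreeGroup.IsReduced ((v, s) :: (l ++ [(v, s')])) := by
  rw [← List.cons_append]
  refine List.IsChain.append (h.cons_isReduced s) (List.isChain_singleton _) ?_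
  intro y hy z hz hyz
  obtain rfl : (v, s') = z := by simpa using hz
  rcases l.eq_nil_or_concat with rfl | ⟨l, w, rfl⟩
  · obtain rfl : (v, s) = y := by simpa using hy
    exact hs rfl
  · obtain rfl : w = y := by simpa [List.getLast?_cons] using hy
    exact absurd hyz (h.2 _ (by simp))

theorem invRev [DecidableEq X] (h : ReducedAvoiding v l) :
    ReducedAvoiding v (FreeGroup.invRev l) := by
  refine ⟨?_, fun y hy => ?_⟩
  · rw [FreeGroup.isReduced_iff_reduce_eq, FreeGroup.reduce_invRev, h.1.reduce_eq]
  · simp only [FreeGroup.invRev, List.mem_reverse, List.mem_map] at hy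
    obtain ⟨z, hz, rfl⟩ := hy
    exact h.2 z hz

end ReducedAvoiding

section LoopGraph

open XDigraph

variable {X : Type} [DecidableEq X] {v : X} {u : FreeGroup X} {S : XDigraph X}

theorem CRep.not_walk_cons_concat (hS : CRep S (loopSubgroup v u)) (hu1 : u ≠ 1)
    (hcyc : FreeGroup.IsCyclicallyReduced u.toWord) (huv : ∀ y ∈ u.toWord, y.1 ≠ v)
    {l : List (X × Bool)} (hl : ReducedAvoiding v l) (a b : S.V) :
    ¬ Walk S.Step a ((v, true) :: (l ++ [(v, true)])) b := by
  intro hw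
  obtain ⟨C, σ, lab, o, pot, h1, h2, h3, -, -⟩ := exists_loopStep hu1 hcyc huv
  have hT := LoopStep.isInverseAutomaton (o := o) h1 h2
  obtain ⟨t, t', c, hs, hw'⟩ := hS.exists_walk_of_walk hT (walk_none_of_mem_loopSubgroup hT h3) hw
    (hl.cons_concat_isReduced fun _ => rfl)
  obtain ⟨d, hl', hs'⟩ := walk_append.1 hw'
  have hc : c = none := hT.det (hT.symm (hT.symm hs)) (by
    rcases t with _ | i
    · rcases LoopStep.eq_or_of_none hs with ⟨h, -⟩ | ⟨h, -⟩
      · exact absurd rfl h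
      · cases h
    · rcases LoopStep.eq_or_of_some hs with ⟨rfl, -, -⟩ | ⟨h, -⟩ | ⟨h, -⟩
      · exact .up
      · exact absurd (congrArg Prod.fst h).symm (h1 _)
      · exact absurd (congrArg Prod.fst h).symm (h1 _))
  subst hc
  obtain rfl := LoopStep.eq_none_of_walk hl.2 hl'
  rcases LoopStep.eq_or_of_none (walk_singleton.1 hs') with ⟨h, -⟩ | ⟨h, -⟩
  · exact h rfl
  · cases h

theorem CRep.mk_mem_zpowers_of_walk (hS : CRep S (loopSubgroup v u)) (hu1 : u ≠ 1)
    (hcyc : FreeGroup.IsCyclicallyReduced u.toWord) (huv : ∀ y ∈ u.toWord, y.1 ≠ v)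
    {l : List (X × Bool)} (hl : ReducedAvoiding v l) (hne : l ≠ []) {a b : S.V}
    (hw : Walk S.Step a ((v, false) :: (l ++ [(v, true)])) b) :
    FreeGroup.mk l ∈ Subgroup.zpowers u := by
  obtain ⟨C, σ, lab, o, pot, h1, h2, h3, h4, h5⟩ := exists_loopStep hu1 hcyc huv
  have hT := LoopStep.isInverseAutomaton (o := o) h1 h2
  obtain ⟨t, t', c, hs, hw'⟩ := hS.exists_walk_of_walk hT (walk_none_of_mem_loopSubgroup hT h3) hw
    (hl.cons_concat_isReduced fun h => absurd h hne)
  obtain ⟨d, hl', hs'⟩ := walk_append.1 hw'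
  have hc : c = some o := by
    rcases t with _ | i
    · rcases LoopStep.eq_or_of_none hs with ⟨h, -⟩ | ⟨-, h⟩
      · exact absurd rfl h
      · exact h
    · rcases LoopStep.eq_or_of_some hs with ⟨-, h, -⟩ | ⟨h, -⟩ | ⟨h, -⟩
      · cases h
      · exact absurd (congrArg Prod.fst h).symm (h1 _)
      · exact absurd (congrArg Prod.fst h).symm (h1 _)
  subst hc
  obtain ⟨j, rfl, hj⟩ := LoopStep.exists_some_of_walk h5 hl.2 hl'
  rcases LoopStep.eq_or_of_some (walk_singleton.1 hs') with ⟨rfl, -, -⟩ | ⟨h, -⟩ | ⟨h, -⟩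
  · simpa [h4] using hj
  · exact absurd (congrArg Prod.fst h).symm (h1 _)
  · exact absurd (congrArg Prod.fst h).symm (h1 _)

/-- On the far side of a `v`-edge, every vertex has at most two outgoing letters other than `v`. -/
theorem CRep.exists_pair_of_walk (hS : CRep S (loopSubgroup v u)) (hu1 : u ≠ 1)
    (hcyc : FreeGroup.IsCyclicallyReduced u.toWord) (huv : ∀ y ∈ u.toWord, y.1 ≠ v)
    {l : List (X × Bool)} (hl : ReducedAvoiding v l) {a b : S.V}
    (hw : Walk S.Step a ((v, false) :: l) b) :
    ∃ y₁ y₂, ∀ y c, y.1 ≠ v → S.Step b y c → y = y₁ ∨ y = y₂ := by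
  obtain ⟨C, σ, lab, o, pot, h1, h2, h3, h4, h5⟩ := exists_loopStep hu1 hcyc huv
  have hT := LoopStep.isInverseAutomaton (o := o) h1 h2
  have hH := walk_none_of_mem_loopSubgroup hT h3
  have hdown : ∀ t c, LoopStep v σ lab o t (v, false) c → c = some o := by
    rintro (_ | i) c hs
    · rcases LoopStep.eq_or_of_none hs with ⟨h, -⟩ | ⟨-, h⟩
      · exact absurd rfl h
      · exact h
    · rcases LoopStep.eq_or_of_some hs with ⟨-, h, -⟩ | ⟨h, -⟩ | ⟨h, -⟩
      · cases h
      · exact absurd (congrArg Prod.fst h).symm (h1 _)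
      · exact absurd (congrArg Prod.fst h).symm (h1 _)
  obtain ⟨t, t', c, hs, hw'⟩ := hS.exists_walk_of_walk hT hH hw (hl.cons_isReduced _)
  obtain rfl := hdown _ _ hs
  obtain ⟨i, rfl, -⟩ := LoopStep.exists_some_of_walk h5 hl.2 hw'
  refine ⟨lab i, ((lab (σ.symm i)).1, !(lab (σ.symm i)).2), fun y c hy hstep => ?_⟩
  obtain ⟨z, hz⟩ : ∃ z, LoopStep v σ lab o (some i) y z := by
    by_cases hlast : ∃ l', l = l' ++ [(y.1, !y.2)]
    · obtain ⟨l', rfl⟩ := hlast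
      obtain ⟨d, -, hd⟩ := walk_append.1 hw'
      exact ⟨d, by simpa using hT.symm (walk_singleton.1 hd)⟩
    · have hred : FreeGroup.IsReduced ((v, false) :: (l ++ [y])) := by
        rw [← List.cons_append]
        refine List.IsChain.append (hl.cons_isReduced _) (List.isChain_singleton _) ?_
        intro p hp q hq hpq
        obtain rfl : y = q := by simpa using hq
        rcases l.eq_nil_or_concat with rfl | ⟨l, w, rfl⟩
        · obtain rfl : (v, false) = p := by simpa using hp
          exact absurd hpq.symm hy
        · obtain rfl : w = p := by simpa [List.getLast?_cons] using hp
          by_contra hne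
          refine hlast ⟨l, ?_⟩
          rw [List.concat_eq_append, ← hpq]
          congr 2
          refine Prod.ext rfl ?_
          revert hne
          cases w.2 <;> cases y.2 <;> simp
      obtain ⟨s, s', c', hs', hw''⟩ := hS.exists_walk_of_walk hT hH
        (l := (v, false) :: (l ++ [y])) (a := a) (b := c)
        (by rw [← List.cons_append]; exact walk_append.2 ⟨b, hw, walk_singleton.2 hstep⟩) hred
      obtain rfl := hdown _ _ hs'
      obtain ⟨d, h6, h7⟩ := walk_append.1 hw''
      obtain rfl := hT.walk_det hw' h6
      exact ⟨s', walk_singleton.1 h7⟩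
  rcases LoopStep.eq_or_of_some hz with ⟨-, rfl, -⟩ | ⟨h, -⟩ | ⟨h, -⟩
  · exact absurd rfl hy
  · exact .inl h
  · exact .inr h

end LoopGraph

section LoopBlock

variable {X : Type} {v : X}

/-- The word `p v⁻¹ q v`. -/
def loopBlock (v : X) (p q : List (X × Bool)) : List (X × Bool) :=
  p ++ (v, false) :: (q ++ [(v, true)])

theorem loopBlock_isReduced {p q : List (X × Bool)} (hp : ReducedAvoiding v p)
    (hq : ReducedAvoiding v q) (hq0 : q ≠ []) : FreeGroup.IsReduced (loopBlock v p q) := by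
  refine List.IsChain.append hp.1 (hq.cons_concat_isReduced fun h => absurd h hq0) ?_
  intro y hy z hz hyz
  obtain rfl : (v, false) = z := by simpa using hz
  exact absurd hyz (hp.2 y (List.mem_of_mem_getLast? hy))

theorem flatMap_loopBlock_isReduced {I : Type} {p q : I → List (X × Bool)}
    (hp : ∀ i, ReducedAvoiding v (p i)) (hp0 : ∀ i, p i ≠ []) (hq : ∀ i, ReducedAvoiding v (q i))
    (hq0 : ∀ i, q i ≠ []) (L : List I) :
    FreeGroup.IsReduced (L.flatMap fun i => loopBlock v (p i) (q i)) ∧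
      (∀ y ∈ (L.flatMap fun i => loopBlock v (p i) (q i)).head?, y.1 ≠ v) ∧
      ∀ y ∈ (L.flatMap fun i => loopBlock v (p i) (q i)).getLast?, y = (v, true) := by
  induction L with
  | nil => simp
  | cons i L ih =>
    obtain ⟨h1, h2, h3⟩ := ih
    rw [List.flatMap_cons]
    refine ⟨List.IsChain.append (loopBlock_isReduced (hp i) (hq i) (hq0 i)) h1 ?_, ?_, ?_⟩
    · intro y hy z hz hyz
      obtain rfl : (v, true) = y := by simpa [loopBlock, List.getLast?_cons] using hy
      exact absurd hyz.symm (h2 z hz)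
    · intro y hy
      obtain ⟨z, l, hz⟩ := List.exists_cons_of_ne_nil (hp0 i)
      obtain rfl : z = y := by simpa [loopBlock, hz] using hy
      exact (hp i).2 _ (by simp [hz])
    · intro y hy
      rcases (L.flatMap fun i => loopBlock v (p i) (q i)).eq_nil_or_concat with h | ⟨l, w, h⟩
      · rw [h] at hy
        simpa [loopBlock, List.getLast?_cons, eq_comm] using hy
      · rw [h] at hy h3
        obtain rfl : w = y := by simpa [List.getLast?_append, List.getLast?_cons] using hy
        exact h3 _ (by simp)

theorem flatMap_loopBlock_isCyclicallyReduced {I : Type} {p q : I → List (X × Bool)}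
    (hp : ∀ i, ReducedAvoiding v (p i)) (hp0 : ∀ i, p i ≠ []) (hq : ∀ i, ReducedAvoiding v (q i))
    (hq0 : ∀ i, q i ≠ []) (L : List I) :
    FreeGroup.IsCyclicallyReduced (L.flatMap fun i => loopBlock v (p i) (q i)) := by
  obtain ⟨h1, h2, h3⟩ := flatMap_loopBlock_isReduced hp hp0 hq hq0 L
  refine ⟨h1, fun y hy z hz hyz => ?_⟩
  rw [h3 y hy] at hyz
  exact absurd hyz.symm (h2 z hz)

theorem mk_loopBlock_mem {u : FreeGroup X} {p q : List (X × Bool)} (hp : ∀ y ∈ p, y.1 ≠ v)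
    (hq : FreeGroup.mk q ∈ Subgroup.zpowers u) :
    FreeGroup.mk (loopBlock v p q) ∈ loopSubgroup v u := by
  obtain ⟨k, hk⟩ := Subgroup.mem_zpowers_iff.1 hq
  have he : FreeGroup.mk (loopBlock v p q) =
      FreeGroup.mk p * ((FreeGroup.of v)⁻¹ * u * FreeGroup.of v) ^ k := by
    have hconj : ((FreeGroup.of v)⁻¹ * u * FreeGroup.of v) ^ k =
        (FreeGroup.of v)⁻¹ * u ^ k * FreeGroup.of v := by
      rw [← inv_inv (FreeGroup.of v), inv_inv (FreeGroup.of v)⁻¹, conj_zpow]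
    rw [hconj, hk, loopBlock, show (v, false) :: (q ++ [(v, true)]) =
        [(v, false)] ++ q ++ [(v, true)] from rfl, ← FreeGroup.mul_mk, ← FreeGroup.mul_mk,
      ← FreeGroup.mul_mk]
    rfl
  rw [he]
  have hv : (FreeGroup.of v)⁻¹ * u * FreeGroup.of v ∈ loopSubgroup v u :=
    Subgroup.subset_closure (Set.mem_union_right _ rfl)
  refine Subgroup.mul_mem _ ?_ (Subgroup.zpow_mem _ hv k)
  exact Subgroup.closure_mono Set.subset_union_left (mk_mem_closure_of_forall_ne hp)

theorem mk_flatMap_loopBlock_mem {I : Type} {u : FreeGroup X} {p q : I → List (X × Bool)}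
    (hp : ∀ i, ReducedAvoiding v (p i)) (hq : ∀ i, FreeGroup.mk (q i) ∈ Subgroup.zpowers u)
    (L : List I) :
    FreeGroup.mk (L.flatMap fun i => loopBlock v (p i) (q i)) ∈ loopSubgroup v u := by
  induction L with
  | nil => exact Subgroup.one_mem _
  | cons i L ih =>
    rw [List.flatMap_cons, ← FreeGroup.mul_mk]
    exact Subgroup.mul_mem _ (mk_loopBlock_mem (hp i).2 (hq i)) ih

end LoopBlock

section Connectivity

open XDigraph

variable {X : Type} {S : XDigraph X} {v : X}

namespace XDigraph

theorem step_init_term (e : S.E) : S.Step (S.init e) (S.lab e, true) (S.term e) :=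
  ⟨(e, true), rfl, rfl, rfl⟩

theorem step_term_init (e : S.E) : S.Step (S.term e) (S.lab e, false) (S.init e) :=
  ⟨(e, false), rfl, rfl, rfl⟩

theorem Step.exists_edge {a b : S.V} {x : X} (h : S.Step a (x, true) b) :
    ∃ e, S.lab e = x ∧ S.init e = a ∧ S.term e = b := by
  obtain ⟨⟨e, s⟩, h1, h2, h3⟩ := h
  simp only [dLab, Prod.mk.injEq] at h2
  obtain ⟨h2, rfl⟩ := h2
  exact ⟨e, h2, h1, h3⟩

theorem Folded.edge_ext_of_init (hF : S.Folded) {e f : S.E} (hl : S.lab e = S.lab f)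
    (h : S.init e = S.init f) : e = f :=
  congrArg Prod.fst (hF.dart_ext_of_dInit (d := (e, true)) (d' := (f, true)) h
    (Prod.ext hl rfl))

theorem Folded.edge_ext_of_term (hF : S.Folded) {e f : S.E} (hl : S.lab e = S.lab f)
    (h : S.term e = S.term f) : e = f :=
  congrArg Prod.fst (hF.dart_ext_of_dInit (d := (e, false)) (d' := (f, false)) h
    (Prod.ext hl rfl))

theorem Folded.exists_walk_of_eqvGen [DecidableEq X] (hF : S.Folded) {a b : S.V}
    (h : Relation.EqvGen (S.AdjOn fun e => S.lab e ≠ v) a b) :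
    ∃ l, ReducedAvoiding v l ∧ Walk S.Step a l b := by
  have hT := hF.isInverseAutomaton
  induction h with
  | rel a b h =>
    obtain ⟨e, he, ⟨rfl, rfl⟩ | ⟨rfl, rfl⟩⟩ := h
    · exact ⟨[(S.lab e, true)], ⟨List.isChain_singleton _, by simpa using he⟩,
        walk_singleton.2 (step_init_term e)⟩
    · exact ⟨[(S.lab e, false)], ⟨List.isChain_singleton _, by simpa using he⟩,
        walk_singleton.2 (step_term_init e)⟩
  | refl a => exact ⟨[], ⟨List.isChain_nil, by simp⟩, rfl⟩
  | symm a b _ ih =>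
    obtain ⟨l, hl, hw⟩ := ih
    exact ⟨_, hl.invRev, hT.walk_invRev hw⟩
  | trans a b c _ _ ih₁ ih₂ =>
    obtain ⟨l₁, hl₁, hw₁⟩ := ih₁
    obtain ⟨l₂, hl₂, hw₂⟩ := ih₂
    refine ⟨FreeGroup.reduce (l₁ ++ l₂),
      ⟨FreeGroup.IsReduced.of_reduce_eq FreeGroup.reduce.idem, fun y hy => ?_⟩,
      hT.walk_red (walk_append.2 ⟨_, hw₁, hw₂⟩) FreeGroup.reduce.red⟩
    rcases List.mem_append.1 ((FreeGroup.Red.sublist FreeGroup.reduce.red).subset hy) with h | h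
    exacts [hl₁.2 y h, hl₂.2 y h]

/-- In a finite folded graph, some uniform positive power of every element labels only closed
walks. -/
theorem Folded.exists_pow_walk_closed [DecidableEq X] (hF : S.Folded) :
    ∃ N : ℕ, 0 < N ∧ ∀ (g : FreeGroup X) (a b : S.V), Walk S.Step a (g ^ N).toWord b → a = b := by
  have hT := hF.isInverseAutomaton
  have hσ : ∀ x, ∃ σ : Equiv.Perm S.V, ∀ a b, S.Step b (x, true) a → σ a = b := fun x =>
    exists_perm_extending (r := fun a b => S.Step b (x, true) a)
      (fun h h' => hT.det (hT.symm h) (hT.symm h')) (fun h h' => hT.det h h')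
  choose σ hσ using hσ
  have hφ : ∀ (l : List (X × Bool)) (a b : S.V), Walk S.Step a l b →
      FreeGroup.lift σ (FreeGroup.mk l) b = a := by
    intro l
    induction l with
    | nil => exact fun a b h => Eq.symm h
    | cons y l ih =>
      rintro a b ⟨c, h1, h2⟩
      rw [show y :: l = [y] ++ l from rfl, ← FreeGroup.mul_mk, map_mul, Equiv.Perm.mul_apply,
        ih c b h2]
      obtain ⟨x, _ | _⟩ := y
      · simpa [FreeGroup.lift_mk, Equiv.symm_apply_eq] using (hσ x a c (hT.symm h1)).symm
      · simpa [FreeGroup.lift_mk] using hσ x c a h1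
  refine ⟨Nat.card (Equiv.Perm S.V), Nat.card_pos, fun g a b hw => ?_⟩
  have := hφ _ a b hw
  rw [FreeGroup.mk_toWord, map_pow, pow_card_eq_one'] at this
  exact this.symm

end XDigraph

end Connectivity

section VEdge

open XDigraph

variable {X : Type} {v : X} {u : FreeGroup X} {S : XDigraph X}

theorem step_init_term_of_lab (e : {e : S.E // S.lab e = v}) :
    S.Step (S.init e) (v, true) (S.term e) := by
  simpa only [e.2] using step_init_term e.1

theorem step_term_init_of_lab (e : {e : S.E // S.lab e = v}) :
    S.Step (S.term e) (v, false) (S.init e) := by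
  simpa only [e.2] using step_term_init e.1

theorem XDigraph.Folded.vEdge_ext_of_init (hF : S.Folded) {e f : {e : S.E // S.lab e = v}}
    (h : S.init e = S.init f) : e = f :=
  Subtype.ext (hF.edge_ext_of_init (e.2.trans f.2.symm) h)

theorem XDigraph.Folded.vEdge_ext_of_term (hF : S.Folded) {e f : {e : S.E // S.lab e = v}}
    (h : S.term e = S.term f) : e = f :=
  Subtype.ext (hF.edge_ext_of_term (e.2.trans f.2.symm) h)

variable [DecidableEq X]

theorem reducedAvoiding_toWord {g : FreeGroup X}
    (hg : g ∈ Subgroup.closure (FreeGroup.of '' {x : X | x ≠ v})) : ReducedAvoiding v g.toWord :=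
  ⟨FreeGroup.isReduced_toWord, mem_toWord_ne_of_mem_closure hg⟩

/-- Labels of the links between `v`-edges: the reduced words of `U`, at the terminal vertex, and
the powers of `u`, at the initial vertex. -/
abbrev LinkIndex (v : X) : Type :=
  {l : List (X × Bool) // ReducedAvoiding v l ∧ l ≠ []} ⊕ {k : ℤ // k ≠ 0}

/-- Two `v`-edges are linked by a word avoiding `v` joining their terminal vertices, or by a power
of `u` joining their initial vertices. -/
def Link (S : XDigraph X) (v : X) (u : FreeGroup X) (e : {e : S.E // S.lab e = v}) :
    LinkIndex v → {e : S.E // S.lab e = v} → Prop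
  | .inl l, f => Walk S.Step (S.term e) l (S.term f)
  | .inr k, f => Walk S.Step (S.init e) (u ^ k.1).toWord (S.init f)

theorem Link.det (hF : S.Folded) {e f g : {e : S.E // S.lab e = v}} {i : LinkIndex v}
    (h : Link S v u e i f) (h' : Link S v u e i g) : f = g := by
  rcases i with l | k
  · exact hF.vEdge_ext_of_term (hF.isInverseAutomaton.walk_det h h')
  · exact hF.vEdge_ext_of_init (hF.isInverseAutomaton.walk_det h h')

theorem Link.det_left (hF : S.Folded) {e f g : {e : S.E // S.lab e = v}} {i : LinkIndex v}
    (h : Link S v u e i g) (h' : Link S v u f i g) : e = f := by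
  rcases i with l | k
  · exact hF.vEdge_ext_of_term (hF.isInverseAutomaton.walk_det_left h h')
  · exact hF.vEdge_ext_of_init (hF.isInverseAutomaton.walk_det_left h h')

theorem CRep.not_eqvGen_term_init (hS : CRep S (loopSubgroup v u)) (hu1 : u ≠ 1)
    (hcyc : FreeGroup.IsCyclicallyReduced u.toWord) (huv : ∀ y ∈ u.toWord, y.1 ≠ v)
    (e f : {e : S.E // S.lab e = v}) :
    ¬ Relation.EqvGen (S.AdjOn fun e => S.lab e ≠ v) (S.term e) (S.init f) := by
  intro h
  obtain ⟨l, hl, hw⟩ := hS.1.exists_walk_of_eqvGen h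
  exact CRep.not_walk_cons_concat hS hu1 hcyc huv hl (S.init e) (S.term f)
    ⟨_, step_init_term_of_lab e, walk_append.2 ⟨_, hw, walk_singleton.2 (step_init_term_of_lab f)⟩⟩

theorem CRep.exists_link_walk_of_eqvGen (hS : CRep S (loopSubgroup v u)) (hu1 : u ≠ 1)
    (hcyc : FreeGroup.IsCyclicallyReduced u.toWord) (huv : ∀ y ∈ u.toWord, y.1 ≠ v)
    {e f : {e : S.E // S.lab e = v}} {a b : S.V} (ha : a = S.init e ∨ a = S.term e)
    (hb : b = S.init f ∨ b = S.term f)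
    (h : Relation.EqvGen (S.AdjOn fun e => S.lab e ≠ v) a b) : ∃ L, Walk (Link S v u) e L f := by
  rcases ha with rfl | rfl <;> rcases hb with rfl | rfl
  · obtain ⟨l, hl, hw⟩ := hS.1.exists_walk_of_eqvGen h
    by_cases hne : l = []
    · subst hne
      exact ⟨[], hS.1.vEdge_ext_of_init hw⟩
    obtain ⟨k, hk⟩ := Subgroup.mem_zpowers_iff.1 <|
      CRep.mk_mem_zpowers_of_walk hS hu1 hcyc huv hl hne (a := S.term e) (b := S.term f)
        ⟨_, step_term_init_of_lab e,
          walk_append.2 ⟨_, hw, walk_singleton.2 (step_init_term_of_lab f)⟩⟩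
    have hl' : (u ^ k).toWord = l := by rw [hk, FreeGroup.toWord_mk, hl.1.reduce_eq]
    refine ⟨[.inr ⟨k, ?_⟩], walk_singleton.2 ?_⟩
    · rintro rfl
      exact hne (by simpa using hl'.symm)
    · simpa only [Link, hl'] using hw
  · exact absurd (h.symm _ _) (CRep.not_eqvGen_term_init hS hu1 hcyc huv f e)
  · exact absurd h (CRep.not_eqvGen_term_init hS hu1 hcyc huv e f)
  · obtain ⟨l, hl, hw⟩ := hS.1.exists_walk_of_eqvGen h
    by_cases hne : l = []
    · subst hne
      exact ⟨[], hS.1.vEdge_ext_of_term hw⟩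
    · exact ⟨[.inl ⟨l, hl, hne⟩], walk_singleton.2 hw⟩

theorem XDigraph.Connected.exists_endpoint_eqvGen (hC : S.Connected)
    {p : {e : S.E // S.lab e = v} → Prop}
    (hp : ∀ (e f : {e : S.E // S.lab e = v}) (a b : S.V), p e →
      (a = S.init e ∨ a = S.term e) → (b = S.init f ∨ b = S.term f) →
      Relation.EqvGen (S.AdjOn fun e => S.lab e ≠ v) a b → p f)
    {e₀ : {e : S.E // S.lab e = v}} (h₀ : p e₀) (w : S.V) :
    ∃ (f : {e : S.E // S.lab e = v}) (a : S.V), p f ∧ (a = S.init f ∨ a = S.term f) ∧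
      Relation.EqvGen (S.AdjOn fun e => S.lab e ≠ v) a w := by
  have hadj : ∀ w w', S.Adj w w' →
      (∃ (f : {e : S.E // S.lab e = v}) (a : S.V), p f ∧ (a = S.init f ∨ a = S.term f) ∧
        Relation.EqvGen (S.AdjOn fun e => S.lab e ≠ v) a w) →
      ∃ (f : {e : S.E // S.lab e = v}) (a : S.V), p f ∧ (a = S.init f ∨ a = S.term f) ∧
        Relation.EqvGen (S.AdjOn fun e => S.lab e ≠ v) a w' := by
    rintro _ _ ⟨⟨e, s⟩, rfl, rfl⟩ ⟨f, a, hf, ha, h⟩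
    by_cases he : S.lab e = v
    · refine ⟨⟨e, he⟩, _, hp f ⟨e, he⟩ a _ hf ha ?_ h, ?_, .refl _⟩ <;> cases s <;>
        simp [dInit, dTerm]
    · refine ⟨f, a, hf, ha, h.trans _ _ _ (Relation.EqvGen.rel _ _ ⟨e, he, ?_⟩)⟩
      cases s <;> simp [dInit, dTerm]
  have hsymm : ∀ w w', S.Adj w w' → S.Adj w' w := by
    rintro _ _ ⟨d, rfl, rfl⟩
    exact ⟨S.dRev d, dInit_dRev d, dTerm_dRev d⟩
  have hiff : ∀ w w', Relation.EqvGen S.Adj w w' →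
      ((∃ (f : {e : S.E // S.lab e = v}) (a : S.V), p f ∧ (a = S.init f ∨ a = S.term f) ∧
        Relation.EqvGen (S.AdjOn fun e => S.lab e ≠ v) a w) ↔
      ∃ (f : {e : S.E // S.lab e = v}) (a : S.V), p f ∧ (a = S.init f ∨ a = S.term f) ∧
        Relation.EqvGen (S.AdjOn fun e => S.lab e ≠ v) a w') := by
    intro w w' h
    induction h with
    | rel w w' h => exact ⟨hadj _ _ h, hadj _ _ (hsymm _ _ h)⟩
    | refl => rfl
    | symm _ _ _ ih => exact ih.symm
    | trans _ _ _ _ _ ih₁ ih₂ => exact ih₁.trans ih₂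
  exact (hiff _ _ (hC.2 (S.init e₀) w)).1 ⟨e₀, _, h₀, .inl rfl, .refl _⟩

theorem CRep.exists_link_walk (hS : CRep S (loopSubgroup v u)) (hu1 : u ≠ 1)
    (hcyc : FreeGroup.IsCyclicallyReduced u.toWord) (huv : ∀ y ∈ u.toWord, y.1 ≠ v)
    (e f : {e : S.E // S.lab e = v}) : ∃ L, Walk (Link S v u) e L f := by
  have hp : ∀ (g g' : {e : S.E // S.lab e = v}) (a b : S.V),
      (∃ L, Walk (Link S v u) e L g) → (a = S.init g.1 ∨ a = S.term g.1) →
      (b = S.init g'.1 ∨ b = S.term g'.1) →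
      Relation.EqvGen (S.AdjOn fun e => S.lab e ≠ v) a b → ∃ L, Walk (Link S v u) e L g' := by
    rintro g g' a b ⟨L, hL⟩ ha hb h
    obtain ⟨L', hL'⟩ := CRep.exists_link_walk_of_eqvGen hS hu1 hcyc huv ha hb h
    exact ⟨L ++ L', walk_append.2 ⟨g, hL, hL'⟩⟩
  obtain ⟨g, a, hg, ha, h⟩ := hS.2.1.exists_endpoint_eqvGen hp ⟨[], rfl⟩ (S.init f)
  exact hp g f a _ hg ha (.inl rfl) h

theorem CRep.exists_link_closed_walk (hS : CRep S (loopSubgroup v u)) (hu1 : u ≠ 1)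
    (hu : u ∈ Subgroup.closure (FreeGroup.of '' {x : X | x ≠ v})) {L : List (LinkIndex v)}
    (hL : L ≠ []) : ∃ e, Walk (Link S v u) e L e := by
  have hF := hS.1
  have hT := hF.isInverseAutomaton
  obtain ⟨N, hN, hclosed⟩ := hF.exists_pow_walk_closed
  obtain ⟨x, hx⟩ : ∃ x, x ≠ v := by
    obtain ⟨y, hy⟩ := List.exists_mem_of_ne_nil _ (mt FreeGroup.toWord_eq_nil_iff.1 hu1)
    exact ⟨y.1, mem_toWord_ne_of_mem_closure hu y hy⟩
  let p : LinkIndex v → List (X × Bool) :=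
    Sum.elim (fun l => l.1) (fun _ => (FreeGroup.of x ^ N).toWord)
  let q : LinkIndex v → List (X × Bool) :=
    Sum.elim (fun _ => (u ^ N).toWord) (fun k => (u ^ k.1).toWord)
  have hxU : FreeGroup.of x ∈ Subgroup.closure (FreeGroup.of '' {x : X | x ≠ v}) :=
    Subgroup.subset_closure ⟨x, hx, rfl⟩
  have hp : ∀ i, ReducedAvoiding v (p i) ∧ p i ≠ [] := by
    rintro (l | k)
    · exact l.2
    · refine ⟨reducedAvoiding_toWord (Subgroup.pow_mem _ hxU N), fun h => ?_⟩
      exact FreeGroup.of_ne_one x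
        ((pow_eq_one_iff_left hN.ne').1 (FreeGroup.toWord_eq_nil_iff.1 h))
  have hq : ∀ i, ReducedAvoiding v (q i) ∧ q i ≠ [] := by
    rintro (l | k)
    · exact ⟨reducedAvoiding_toWord (Subgroup.pow_mem _ hu N), fun h =>
        hu1 ((pow_eq_one_iff_left hN.ne').1 (FreeGroup.toWord_eq_nil_iff.1 h))⟩
    · exact ⟨reducedAvoiding_toWord (Subgroup.zpow_mem _ hu k.1), fun h =>
        hu1 ((IsMulTorsionFree.zpow_eq_one_iff_left k.2).1 (FreeGroup.toWord_eq_nil_iff.1 h))⟩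
  have hqu : ∀ i, FreeGroup.mk (q i) ∈ Subgroup.zpowers u := by
    rintro (l | k)
    · exact FreeGroup.mk_toWord (x := u ^ N) ▸ Subgroup.npow_mem_zpowers u N
    · exact FreeGroup.mk_toWord (x := u ^ k.1) ▸ Subgroup.zpow_mem_zpowers u k.1
  have hblock : ∀ (i : LinkIndex v) {a b : S.V}, Walk S.Step a (loopBlock v (p i) (q i)) b →
      ∃ f : {e : S.E // S.lab e = v}, S.term f = b ∧
        ∀ e : {e : S.E // S.lab e = v}, S.term e = a → Link S v u e i f := by
    intro i a b hw
    obtain ⟨c, h1, d, h2, h3⟩ := walk_append.1 hw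
    obtain ⟨d', h5, h4⟩ := walk_append.1 h3
    obtain ⟨f, hf, rfl, rfl⟩ := (walk_singleton.1 h4).exists_edge
    obtain ⟨g, hg, rfl, rfl⟩ := (hT.symm h2).exists_edge
    refine ⟨⟨f, hf⟩, rfl, ?_⟩
    rintro e rfl
    rcases i with l | k
    · obtain rfl := hF.edge_ext_of_init (hg.trans hf.symm) (hclosed _ _ _ h5)
      exact h1
    · obtain rfl := hF.edge_ext_of_term (e.2.trans hg.symm) (hclosed _ _ _ h1)
      exact h5
  have hdecode : ∀ (L : List (LinkIndex v)) (e : {e : S.E // S.lab e = v}) (b : S.V),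
      Walk S.Step (S.term e) (L.flatMap fun i => loopBlock v (p i) (q i)) b →
      ∃ f : {e : S.E // S.lab e = v}, S.term f = b ∧ Walk (Link S v u) e L f := by
    intro L
    induction L with
    | nil => exact fun e b h => ⟨e, h, rfl⟩
    | cons i L ih =>
      intro e b h
      obtain ⟨c, h1, h2⟩ := walk_append.1 h
      obtain ⟨f, rfl, hf⟩ := hblock i h1
      obtain ⟨g, rfl, hg⟩ := ih f b h2
      exact ⟨g, rfl, f, hf e rfl, hg⟩
  obtain ⟨a, ha⟩ := CRep.exists_walk hS
    (flatMap_loopBlock_isCyclicallyReduced (fun i => (hp i).1) (fun i => (hp i).2)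
      (fun i => (hq i).1) (fun i => (hq i).2) L)
    (mk_flatMap_loopBlock_mem (fun i => (hp i).1) hqu L)
  obtain ⟨e, rfl⟩ : ∃ e : {e : S.E // S.lab e = v}, S.term e = a := by
    obtain ⟨L', i, rfl⟩ := (List.eq_nil_or_concat L).resolve_left hL
    rw [List.concat_eq_append, List.flatMap_append, walk_append] at ha
    obtain ⟨c, -, hc⟩ := ha
    obtain ⟨f, hf, -⟩ := hblock i (by simpa using hc)
    exact ⟨f, hf⟩
  obtain ⟨f, hf, hw⟩ := hdecode L e _ ha
  obtain rfl := hF.vEdge_ext_of_term hf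
  exact ⟨_, hw⟩

theorem CRep.exists_unique_vEdge (hS : CRep S (loopSubgroup v u)) (hu1 : u ≠ 1)
    (hcyc : FreeGroup.IsCyclicallyReduced u.toWord)
    (hu : u ∈ Subgroup.closure (FreeGroup.of '' {x : X | x ≠ v})) :
    ∃ e₀, S.lab e₀ = v ∧ (∀ e, S.lab e = v → e = e₀) ∧
      Walk S.Step (S.init e₀) u.toWord (S.init e₀) := by
  have huv := mem_toWord_ne_of_mem_closure hu
  obtain ⟨e, he⟩ := CRep.exists_link_closed_walk hS hu1 hu
    (L := [.inr ⟨1, one_ne_zero⟩]) (List.cons_ne_nil _ _)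
  have hsub : Subsingleton {e : S.E // S.lab e = v} := by
    refine subsingleton_of_forall_exists_closed_walk (R := Link S v u) (Link.det hS.1)
      (Link.det_left hS.1) (CRep.exists_link_walk hS hu1 hcyc huv) fun L => ?_
    by_cases hL : L = []
    · exact ⟨e, by rw [hL]; rfl⟩
    · exact CRep.exists_link_closed_walk hS hu1 hu hL
  refine ⟨e, e.2, fun f hf => ?_, ?_⟩
  · exact congrArg Subtype.val (Subsingleton.elim (⟨f, hf⟩ : {e : S.E // S.lab e = v}) e)
  · simpa [Link, walk_singleton] using he

end VEdge

section RankOne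

open XDigraph

variable {X : Type} {S : XDigraph X}

/-- A union of components all of whose vertices have degree two has as many edges as vertices. -/
theorem XDigraph.card_edges_eq_card_vertices {P : S.E → Prop} {C : S.V → Prop}
    (hC : ∀ e, P e → (C (S.init e) ↔ C (S.term e)))
    (hdeg : ∀ w, C w → Nat.card {d : S.Dart // S.dInit d = w ∧ P d.1} = 2) :
    Nat.card {e : S.E // P e ∧ C (S.init e)} = Nat.card {w : S.V // C w} := by
  classical
  have hdart : ∀ d : S.Dart, P d.1 → (C (S.dInit d) ↔ C (S.init d.1)) := by
    rintro ⟨e, _ | _⟩ he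
    exacts [(hC e he).symm, Iff.rfl]
  simp only [Nat.card_eq_fintype_card, Fintype.card_subtype] at hdeg ⊢
  have h1 : (Finset.univ.filter fun d : S.Dart => P d.1 ∧ C (S.init d.1)).card =
      (Finset.univ.filter C).card * 2 := by
    rw [Finset.card_eq_sum_card_fiberwise (f := S.dInit) (t := Finset.univ.filter C)]
    · refine Finset.sum_const_nat fun w hw => ?_
      have hw := (Finset.mem_filter.1 hw).2
      rw [← hdeg w hw, Finset.filter_filter]
      congr 1
      refine Finset.filter_congr fun d _ => ?_
      constructor
      · exact fun h => ⟨h.2, h.1.1⟩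
      · exact fun h => ⟨⟨h.2, (hdart d h.2).1 (h.1 ▸ hw)⟩, h.1⟩
    · intro d hd
      obtain ⟨hP, hCd⟩ := (Finset.mem_filter.1 (Finset.mem_coe.1 hd)).2
      exact Finset.mem_coe.2 (Finset.mem_filter.2 ⟨Finset.mem_univ _, (hdart d hP).2 hCd⟩)
  have h2 : (Finset.univ.filter fun d : S.Dart => P d.1 ∧ C (S.init d.1)) =
      (Finset.univ.filter fun e : S.E => P e ∧ C (S.init e)) ×ˢ (Finset.univ : Finset Bool) := by
    ext d
    simp
  rw [h2, Finset.card_product, Finset.card_univ, Fintype.card_bool] at h1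
  exact Nat.eq_of_mul_eq_mul_right two_pos h1

variable [DecidableEq X] {v : X} {u : FreeGroup X}

theorem CRep.card_darts_eq_two (hS : CRep S (loopSubgroup v u)) (hu1 : u ≠ 1)
    (hcyc : FreeGroup.IsCyclicallyReduced u.toWord) (huv : ∀ y ∈ u.toWord, y.1 ≠ v)
    {e₀ : S.E} (he₀ : S.lab e₀ = v) (hunique : ∀ e, S.lab e = v → e = e₀)
    (hloop : Walk S.Step (S.init e₀) u.toWord (S.init e₀)) {w : S.V}
    (hw : Relation.EqvGen (S.AdjOn fun e => S.lab e ≠ v) (S.init e₀) w) :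
    Nat.card {d : S.Dart // S.dInit d = w ∧ S.lab d.1 ≠ v} = 2 := by
  classical
  have hF := hS.1
  rw [Nat.card_eq_fintype_card, Fintype.card_subtype]
  obtain ⟨l, hl, hlw⟩ := hF.exists_walk_of_eqvGen hw
  refine le_antisymm ?_ ?_
  · obtain ⟨y₁, y₂, hy⟩ := CRep.exists_pair_of_walk hS hu1 hcyc huv hl (a := S.term e₀) (b := w)
      ⟨_, step_term_init_of_lab ⟨e₀, he₀⟩, hlw⟩
    refine le_trans (Finset.card_le_card_of_injOn (t := {y₁, y₂}) S.dLab ?_ ?_) Finset.card_le_two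
    · intro d hd
      obtain ⟨hdw, hdv⟩ := (Finset.mem_filter.1 (Finset.mem_coe.1 hd)).2
      simpa using hy (S.dLab d) (S.dTerm d) hdv ⟨d, hdw, rfl, rfl⟩
    · intro d hd d' hd' h
      have hd := (Finset.mem_filter.1 (Finset.mem_coe.1 hd)).2.1
      have hd' := (Finset.mem_filter.1 (Finset.mem_coe.1 hd')).2.1
      exact hF.dart_ext_of_dInit (hd.trans hd'.symm) h
  · by_cases hwe : w = S.init e₀
    · subst hwe
      have hne : u.toWord ≠ [] := mt FreeGroup.toWord_eq_nil_iff.1 hu1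
      obtain ⟨y, t, hy⟩ := List.exists_cons_of_ne_nil hne
      obtain ⟨t', z, hz⟩ := (List.eq_nil_or_concat _).resolve_left hne
      have hfirst := hloop
      rw [hy] at hfirst
      obtain ⟨c, ⟨d, hd1, hd2, -⟩, -⟩ := hfirst
      rw [hz, List.concat_eq_append, walk_append] at hloop
      obtain ⟨c', -, hc'⟩ := hloop
      obtain ⟨d', -, hd2', hd3'⟩ := walk_singleton.1 hc'
      refine Finset.one_lt_card.2 ⟨d, ?_, S.dRev d', ?_, ?_⟩
      · exact Finset.mem_filter.2 ⟨Finset.mem_univ _, hd1,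
          by simpa [← hd2, dLab] using huv y (by simp [hy])⟩
      · refine Finset.mem_filter.2 ⟨Finset.mem_univ _, by simpa using hd3', ?_⟩
        simpa [← hd2', dLab, dRev] using huv z (by simp [hz])
      · rintro rfl
        have h := hcyc.2 z (by simp [hz]) y (by simp [hy])
        simp [← hd2, ← hd2', dLab, dRev] at h
    · obtain ⟨l', z, rfl⟩ := (List.eq_nil_or_concat l).resolve_left fun h => by
        subst h
        exact hwe (Eq.symm hlw)
      rw [List.concat_eq_append, walk_append] at hlw
      obtain ⟨c, -, hc⟩ := hlw
      obtain ⟨d, -, -, rfl⟩ := walk_singleton.1 hc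
      have hdeg := hS.2.2.1.two_le_degree d
      rw [← card_dInit_eq_degree] at hdeg
      refine hdeg.trans (Finset.card_le_card fun d' hd' => ?_)
      have hd' := (Finset.mem_filter.1 hd').2
      refine Finset.mem_filter.2 ⟨Finset.mem_univ _, hd', fun hv => ?_⟩
      obtain ⟨e, s⟩ := d'
      obtain rfl := hunique e hv
      cases s
      · refine CRep.not_eqvGen_term_init hS hu1 hcyc huv ⟨e, hv⟩ ⟨e, hv⟩ ?_
        rw [show S.term e = S.dTerm d from hd']
        exact hw.symm _ _
      · exact hwe hd'.symm

end RankOne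

/-- for a partition `X = U ⊔ {v}` and a nontrivial cyclically reduced
`u ∈ ⟨U⟩`, the Stallings graph of `⟨U, v⁻¹ u v⟩` has a unique `v`-edge whose deletion
yields two connected components, one of which has rank one (Property (L)). -/
theorem loop_vertex_subgroup_satisfies_propertyL
    {X : Type} [Fintype X] [DecidableEq X] (v : X) (u : FreeGroup X)
    (hu : u ∈ Subgroup.closure (FreeGroup.of '' {x : X | x ≠ v}))
    (hu1 : u ≠ 1) (hucyc : CyclRed u)
    (S : XDigraph X)
    (hS : CRep S (Subgroup.closure
      ((FreeGroup.of '' {x : X | x ≠ v}) ∪ {(FreeGroup.of v)⁻¹ * u * FreeGroup.of v}))) :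
    PropertyL S v := by
  have hcyc := cyclRed_iff_isCyclicallyReduced.1 hucyc
  have huv := mem_toWord_ne_of_mem_closure hu
  obtain ⟨e₀, he₀, hunique, hloop⟩ := CRep.exists_unique_vEdge hS hu1 hcyc hu
  have hP : (fun e => e ≠ e₀) = fun e => S.lab e ≠ v := by
    funext e
    exact propext ⟨fun h h' => h (hunique e h'), fun h h' => h (h' ▸ he₀)⟩
  refine ⟨e₀, he₀, hunique, ?_, S.init e₀, ?_⟩
  · rw [hP, componentsCount, Nat.card_eq_two_iff]
    refine ⟨Quotient.mk _ ⟨S.init e₀, trivial⟩, Quotient.mk _ ⟨S.term e₀, trivial⟩, ?_, ?_⟩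
    · intro h
      exact CRep.not_eqvGen_term_init hS hu1 hcyc huv ⟨e₀, he₀⟩ ⟨e₀, he₀⟩
        (Relation.EqvGen.symm _ _ (Quotient.exact h))
    · refine Set.eq_univ_of_forall fun x => ?_
      induction x using Quotient.inductionOn with | h w => ?_
      obtain ⟨f, a, -, ha, h⟩ := hS.2.1.exists_endpoint_eqvGen (v := v) (p := fun _ => True)
        (fun _ _ _ _ _ _ _ _ => trivial) (e₀ := ⟨e₀, he₀⟩) trivial w.1
      have hf := hunique f f.2
      rcases ha with rfl | rfl
      · exact .inl (Quotient.sound (Relation.EqvGen.symm _ _ (hf ▸ h)))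
      · exact .inr (Quotient.sound (Relation.EqvGen.symm _ _ (hf ▸ h)))
  · rw [ComponentRankOne, hP]
    simp only [ne_eq, fun e => congrFun hP e]
    refine XDigraph.card_edges_eq_card_vertices (P := fun e => S.lab e ≠ v) (fun e he => ?_)
      fun w hw => CRep.card_darts_eq_two hS hu1 hcyc huv he₀ hunique hloop hw
    have hrel : Relation.EqvGen (S.AdjOn fun e => S.lab e ≠ v) (S.init e) (S.term e) :=
      .rel _ _ ⟨e, he, .inl ⟨rfl, rfl⟩⟩
    exact ⟨fun h => h.trans _ _ _ hrel, fun h => h.trans _ _ _ (hrel.symm _ _)⟩
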